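/- Let Γ be a nonempty set of measurable functions on X with α ≤ h ≤ β for all h ∈ Γ (α < β), admitting a countable subset Γ₀ ⊂ Γ such that every h ∈ Γ is a pointwise limit of a sequence from Γ₀. Let 0 ≤ a < 1 < b ≤ ∞ and f ∈ F₁(a,b) be strictly convex in a neighborhood of 1 with z₀ + β − α in the interior of {f* < ∞}, where z₀ := f'_+(1). Let Q, P be probability measures on X, let X₁,…,X_n ~ Q and X'₁,…,X'_m ~ P be jointly independent samples, with empirical measures Q_n, P_m. Then for every ε > 0: ℙ( D_f^Γ(Q_n‖P_m) − D_f^Γ(Q‖P) ≥ ε + 2 R_{Γ,Q,n} + 2 K_{f,Γ,P,m} ) ≤ exp( −2ε² / ( (1/n)(β−α)² + (1/m) Δ_{f,m}² ) ). -/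

import Mathlib

open MeasureTheory Set Filter Topology
open scoped ENNReal NNReal Classical

noncomputable section

/-- The interval `(a, b)` with `b` possibly infinite. -/
def Dom (a : ℝ) (b : EReal) : Set ℝ := {t : ℝ | a < t ∧ (t : EReal) < b}

/-- Legendre transform of `f` on `(a,b)`, with values in `(-∞, ∞]` (modeled by `EReal`). -/
def fStar (f : ℝ → ℝ) (a : ℝ) (b : EReal) (z : ℝ) : EReal :=
  ⨆ t ∈ Dom a b, ((z * t - f t : ℝ) : EReal)

/-- Real-valued version of the Legendre transform (junk value where it is `⊤`). -/
def fStarR (f : ℝ → ℝ) (a : ℝ) (b : EReal) (z : ℝ) : ℝ := (fStar f a b z).toReal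

/-- Right derivative of `g` at `z`. -/
def rderiv (g : ℝ → ℝ) (z : ℝ) : ℝ := derivWithin g (Ici z) z

/-- `z₀ := f'_+(1)`. -/
def zz (f : ℝ → ℝ) : ℝ := rderiv f 1

/-- Integral of an `EReal`-valued function: the Bochner integral if the function is
a.e. finite and integrable, and `⊤` otherwise. -/
def eIntegral {X : Type*} [MeasurableSpace X] (P : Measure X) (g : X → EReal) : EReal :=
  if (∀ᵐ x ∂P, g x ≠ ⊤) ∧ Integrable (fun x => (g x).toReal) P
  then ((∫ x, (g x).toReal ∂P : ℝ) : EReal) else ⊤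

/-- The generalized cumulant generating function `Λ_f^P[h]`. -/
def cgf {X : Type*} [MeasurableSpace X] (f : ℝ → ℝ) (a : ℝ) (b : EReal)
    (P : Measure X) (h : X → ℝ) : EReal :=
  ⨅ ν : ℝ, ((ν : EReal) + eIntegral P (fun x => fStar f a b (h x - ν)))

/-- Real-valued `Λ_f^P[h]`. -/
def cgfR {X : Type*} [MeasurableSpace X] (f : ℝ → ℝ) (a : ℝ) (b : EReal)
    (P : Measure X) (h : X → ℝ) : ℝ := (cgf f a b P h).toReal

/-- `Λ_f : ℝⁿ → ℝ` (with values in `EReal`). -/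
def lamVec (f : ℝ → ℝ) (a : ℝ) (b : EReal) {n : ℕ} (x : Fin n → ℝ) : EReal :=
  ⨅ ν : ℝ, ((ν : EReal) + ((n : ℝ)⁻¹ : EReal) * ∑ i, fStar f a b (x i - ν))

/-- Empirical measure of `n` points. -/
def empMeas {X : Type*} [MeasurableSpace X] (n : ℕ) (xs : Fin n → X) : Measure X :=
  (n : ℝ≥0∞)⁻¹ • ∑ i, Measure.dirac (xs i)

/-- The `(f,Γ)`-divergence `D_f^Γ(Q‖P)`. -/
def Dfg {X : Type*} [MeasurableSpace X] (f : ℝ → ℝ) (a : ℝ) (b : EReal)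
    (Γ : Set (X → ℝ)) (Q P : Measure X) : ℝ :=
  sSup {r : ℝ | ∃ h ∈ Γ, r = ∫ x, h x ∂Q - cgfR f a b P h}

/-- Empirical Rademacher complexity of `Ψ` at the sample `y`. -/
def empRad {Y : Type*} (Ψ : Set (Y → ℝ)) (n : ℕ) (y : Fin n → Y) : ℝ :=
  (2 ^ n : ℝ)⁻¹ * ∑ σ : Fin n → Bool,
    sSup {r : ℝ | ∃ ψ ∈ Ψ, r = (n : ℝ)⁻¹ * ∑ i, (if σ i then 1 else -1) * ψ (y i)}

/-- Rademacher complexity of `Ψ` relative to `P` with `n` samples. -/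
def rad {Y : Type*} [MeasurableSpace Y] (Ψ : Set (Y → ℝ)) (P : Measure Y) (n : ℕ) : ℝ :=
  ∫ y, empRad Ψ n y ∂(Measure.pi fun _ : Fin n => P)

/-- `Δ_{f,n}`. -/
def Δq (f : ℝ → ℝ) (a : ℝ) (b : EReal) (α β : ℝ) (n : ℕ) : ℝ :=
  sInf ((fun z => (n : ℝ) * (-z + (((n : ℝ) - 1) / (n : ℝ)) * fStarR f a b z
      + (1 / (n : ℝ)) * fStarR f a b (β - α + z))) '' Icc (zz f - (β - α)) (zz f))

/-- `sup_{h ∈ Γ} inf_{h̃ ∈ Γ̃} ‖h − h̃‖_∞`. -/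
def approxErr {X : Type*} (Γ Γt : Set (X → ℝ)) : ℝ :=
  sSup {r : ℝ | ∃ h ∈ Γ, r = sInf {s : ℝ | ∃ ht ∈ Γt, s = ⨆ x, |h x - ht x|}}

/-- A countable subset which is pointwise-limit dense. -/
def PtwiseDenseCount {X : Type*} (Γ : Set (X → ℝ)) : Prop :=
  ∃ Γ₀ ⊆ Γ, Γ₀.Countable ∧ ∀ h ∈ Γ, ∃ s : ℕ → X → ℝ,
    (∀ j, s j ∈ Γ₀) ∧ ∀ x, Tendsto (fun j => s j x) atTop (𝓝 (h x))

/-- The quantity `K_{f,Ψ,P,n}` from Definition 3.4: either `(f*)'_+` is Lipschitz on the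
relevant interval and `Ψ` contains a constant, in which case `K` is the minimum of the two
expressions, or `K` is the second expression. -/
def Kchoice (f : ℝ → ℝ) (a : ℝ) (b : EReal) (α β : ℝ) {Y : Type*} [MeasurableSpace Y]
    (Ψ : Set (Y → ℝ)) (P : Measure Y) (n : ℕ) (K : ℝ) : Prop :=
  (∃ L : ℝ≥0, LipschitzOnWith L (rderiv (fStarR f a b))
      (Icc (zz f - (β - α)) (zz f + (β - α))) ∧
    (∃ c : ℝ, (fun _ => c) ∈ Ψ) ∧
    K = min ((1 + 2 * (β - α) * (L : ℝ)) * rad Ψ P n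
        + (β - α) ^ 2 * (L : ℝ) / (2 * Real.sqrt n))
      (rderiv (fStarR f a b) (β - α + zz f) * (rad Ψ P n + (β - α) / (2 * Real.sqrt n))))
  ∨ K = rderiv (fStarR f a b) (β - α + zz f) * (rad Ψ P n + (β - α) / (2 * Real.sqrt n))

/-- Covering number of a (pseudo)metric space by `ε`-balls. -/
def coverNum (Θ : Type*) [PseudoMetricSpace Θ] (ε : ℝ) : ℝ≥0∞ :=
  ⨅ s ∈ {s : Finset Θ | ∀ θ : Θ, ∃ c ∈ s, dist θ c ≤ ε}, ((s.card : ℝ≥0∞))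

end

open ProbabilityTheory in
/-- Sub-Gaussianity tensorizes: if `F (a, ·)` is sub-Gaussian around its mean for every `a`, and
the mean is a sub-Gaussian function of `a`, then `F` is sub-Gaussian for the product measure. -/
lemma hasSubgaussianMGF_prod {A B : Type*} [MeasurableSpace A] [MeasurableSpace B]
    (μ : Measure A) (ν : Measure B) [IsProbabilityMeasure μ] [IsProbabilityMeasure ν]
    {F : A × B → ℝ} (hF : Measurable F) {M : ℝ} (hM : ∀ z, |F z| ≤ M) {c₁ c₂ : ℝ≥0}
    (h₁ : ∀ a, HasSubgaussianMGF (fun b => F (a, b) - ∫ b, F (a, b) ∂ν) c₁ ν)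
    (h₂ : HasSubgaussianMGF
      (fun a => (∫ b, F (a, b) ∂ν) - ∫ a, ∫ b, F (a, b) ∂ν ∂μ) c₂ μ) :
    HasSubgaussianMGF (fun z => F z - ∫ z, F z ∂(μ.prod ν)) (c₁ + c₂) (μ.prod ν) := by
  have hFi : Integrable F (μ.prod ν) :=
    Integrable.of_bound hF.aestronglyMeasurable M (ae_of_all _ fun z => by simpa using hM z)
  have hint : ∀ t : ℝ, Integrable
      (fun z => Real.exp (t * (F z - ∫ z, F z ∂(μ.prod ν)))) (μ.prod ν) := by
    intro t
    refine integrable_exp_mul_of_mem_Icc (a := -M - ∫ z, F z ∂(μ.prod ν))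
      (b := M - ∫ z, F z ∂(μ.prod ν)) (hF.sub_const _).aemeasurable (ae_of_all _ fun z => ?_)
    have := abs_le.1 (hM z)
    constructor <;> linarith
  refine ⟨hint, fun t => ?_⟩
  have hFub : ∫ z, F z ∂(μ.prod ν) = ∫ a, ∫ b, F (a, b) ∂ν ∂μ := integral_prod _ hFi
  have key : ∀ a, ∫ b, Real.exp (t * (F (a, b) - ∫ z, F z ∂(μ.prod ν))) ∂ν
      ≤ Real.exp (c₁ * t ^ 2 / 2) *
        Real.exp (t * ((∫ b, F (a, b) ∂ν) - ∫ a, ∫ b, F (a, b) ∂ν ∂μ)) := by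
    intro a
    have h := (h₁ a).mgf_le t
    rw [mgf] at h
    calc ∫ b, Real.exp (t * (F (a, b) - ∫ z, F z ∂(μ.prod ν))) ∂ν
        = ∫ b, Real.exp (t * (F (a, b) - ∫ b, F (a, b) ∂ν)) *
          Real.exp (t * ((∫ b, F (a, b) ∂ν) - ∫ a, ∫ b, F (a, b) ∂ν ∂μ)) ∂ν := by
          congr 1
          ext b
          rw [← Real.exp_add, hFub]
          congr 1
          ring
      _ = (∫ b, Real.exp (t * (F (a, b) - ∫ b, F (a, b) ∂ν)) ∂ν) *
          Real.exp (t * ((∫ b, F (a, b) ∂ν) - ∫ a, ∫ b, F (a, b) ∂ν ∂μ)) :=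
          integral_mul_const _ _
      _ ≤ _ := by gcongr
  rw [mgf, integral_prod _ (hint t)]
  calc ∫ a, ∫ b, Real.exp (t * (F (a, b) - ∫ z, F z ∂(μ.prod ν))) ∂ν ∂μ
      ≤ ∫ a, Real.exp (c₁ * t ^ 2 / 2) *
        Real.exp (t * ((∫ b, F (a, b) ∂ν) - ∫ a, ∫ b, F (a, b) ∂ν ∂μ)) ∂μ :=
        integral_mono (hint t).integral_prod_left ((h₂.integrable_exp_mul t).const_mul _) key
    _ = Real.exp (c₁ * t ^ 2 / 2) * mgf
        (fun a => (∫ b, F (a, b) ∂ν) - ∫ a, ∫ b, F (a, b) ∂ν ∂μ) μ t := by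
        rw [integral_const_mul, mgf]
    _ ≤ Real.exp (c₁ * t ^ 2 / 2) * Real.exp (c₂ * t ^ 2 / 2) := by
        gcongr
        exact h₂.mgf_le t
    _ = Real.exp ((c₁ + c₂ : ℝ≥0) * t ^ 2 / 2) := by
        rw [← Real.exp_add]
        push_cast
        congr 1
        ring

open ProbabilityTheory in
/-- Hoeffding's lemma for a function of oscillation at most `c`. -/
lemma hasSubgaussianMGF_of_forall_sub_le {A : Type*} [MeasurableSpace A] (μ : Measure A)
    [IsProbabilityMeasure μ] {H : A → ℝ} (hH : Measurable H) {c : ℝ≥0}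
    (hd : ∀ x y, H x - H y ≤ c) :
    HasSubgaussianMGF (fun a => H a - ∫ a, H a ∂μ) ((c / 2) ^ 2) μ := by
  have := nonempty_of_isProbabilityMeasure μ
  obtain ⟨a₀⟩ := id this
  have hbdd : BddBelow (range H) := ⟨H a₀ - c, by
    rintro _ ⟨x, rfl⟩
    linarith [hd a₀ x]⟩
  have h := hasSubgaussianMGF_of_mem_Icc (μ := μ) (X := H) (a := ⨅ a, H a)
    (b := (⨅ a, H a) + c) hH.aemeasurable (ae_of_all _ fun x => ⟨ciInf_le hbdd x, by
      have : H x - c ≤ ⨅ a, H a := le_ciInf fun y => by linarith [hd x y]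
      linarith⟩)
  simpa using h

open ProbabilityTheory in
/-- **McDiarmid's inequality**, sub-Gaussian form: a function with bounded differences of
independent identically distributed variables is sub-Gaussian. -/
lemma hasSubgaussianMGF_pi {A : Type*} [MeasurableSpace A] (μ : Measure A)
    [IsProbabilityMeasure μ] (c : ℝ≥0) {M : ℝ} (n : ℕ) {F : (Fin n → A) → ℝ}
    (hF : Measurable F) (hM : ∀ z, |F z| ≤ M)
    (hd : ∀ x i y, F (Function.update x i y) - F x ≤ c) :
    HasSubgaussianMGF (fun z => F z - ∫ z, F z ∂(Measure.pi fun _ : Fin n => μ))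
      (n * (c / 2) ^ 2) (Measure.pi fun _ : Fin n => μ) := by
  induction n with
  | zero =>
    have : (fun z => F z - ∫ z, F z ∂(Measure.pi fun _ : Fin 0 => μ)) = fun _ => 0 := by
      ext z
      have : F = fun _ => F z := by
        ext w
        rw [Subsingleton.elim w z]
      rw [this]
      simp
    rw [this]
    simp
  | succ n ih =>
    let e := MeasurableEquiv.piFinSuccAbove (fun _ : Fin (n + 1) => A) 0
    have he : MeasurePreserving e (Measure.pi fun _ : Fin (n + 1) => μ)
        (μ.prod (Measure.pi fun _ : Fin n => μ)) :=
      measurePreserving_piFinSuccAbove (fun _ : Fin (n + 1) => μ) 0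
    have hes : ∀ a b, e.symm (a, b) = Fin.cons a b := fun a b => by
      ext j
      simp [e, MeasurableEquiv.piFinSuccAbove]
    have hm : Measurable fun z => F (e.symm z) := hF.comp e.symm.measurable
    have hint : ∀ a, Integrable (fun b => F (e.symm (a, b))) (Measure.pi fun _ : Fin n => μ) :=
      fun a => Integrable.of_bound (hm.comp measurable_prodMk_left).aestronglyMeasurable M
        (ae_of_all _ fun z => by simpa using hM _)
    have hp := hasSubgaussianMGF_prod μ (Measure.pi fun _ : Fin n => μ)
      (F := fun z => F (e.symm z)) hm (fun z => hM _) (c₁ := n * (c / 2) ^ 2)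
      (c₂ := (c / 2) ^ 2)
      (fun a => ih (hm.comp measurable_prodMk_left) (fun z => hM _) (fun x i y => by
        rw [hes, hes, Fin.cons_update (α := fun _ => A)]
        exact hd _ _ _))
      (hasSubgaussianMGF_of_forall_sub_le μ
        (H := fun a => ∫ b, F (e.symm (a, b)) ∂(Measure.pi fun _ : Fin n => μ))
        hm.stronglyMeasurable.integral_prod_right'.measurable (fun x y => by
          rw [← integral_sub (hint x) (hint y)]
          calc _ ≤ ∫ b, (c : ℝ) ∂(Measure.pi fun _ : Fin n => μ) := by
                refine integral_mono ((hint x).sub (hint y)) (integrable_const _) fun b => ?_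
                have := hd (e.symm (y, b)) 0 x
                rw [hes, Fin.update_cons_zero] at this
                simpa only [hes] using this
            _ = c := by simp))
    rw [← he.map_eq] at hp
    have := hp.of_map he.measurable.aemeasurable
    rw [integral_map_equiv] at this
    convert this using 1
    · ext z
      simp
    · push_cast
      ring

/-- The sign in `{-1, 1}` attached to a Boolean. -/
noncomputable def boolSign (s : Bool) : ℝ := if s then 1 else -1

/-- The normalized Rademacher sum `m⁻¹ ∑ₖ σₖ wₖ`. -/
noncomputable def radSum {m : ℕ} (σ : Fin m → Bool) (w : Fin m → ℝ) : ℝ :=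
  (m : ℝ)⁻¹ * ∑ k, boolSign (σ k) * w k

/-- Rademacher average of a family of vectors. -/
noncomputable def famRad {ι : Type*} {m : ℕ} (w : ι → Fin m → ℝ) : ℝ :=
  (2 ^ m : ℝ)⁻¹ * ∑ σ : Fin m → Bool, ⨆ i, radSum σ (w i)

lemma abs_boolSign (s : Bool) : |boolSign s| = 1 := by
  cases s <;> simp [boolSign]

lemma boolSign_not (s : Bool) : boolSign (!s) = -boolSign s := by
  cases s <;> simp [boolSign]

lemma boolSign_mul_self (s : Bool) : boolSign s * boolSign s = 1 := by
  cases s <;> simp [boolSign]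

/-- Negation of the `j`-th Boolean, as a permutation. -/
def flipAt {m : ℕ} (j : Fin m) : Equiv.Perm (Fin m → Bool) :=
  Function.Involutive.toPerm (fun σ => Function.update σ j (!σ j)) fun σ => by simp

lemma flipAt_same {m : ℕ} (j : Fin m) (σ : Fin m → Bool) : flipAt j σ j = !σ j := by
  change Function.update σ j (!σ j) j = !σ j
  simp

lemma flipAt_of_ne {m : ℕ} {j k : Fin m} (h : k ≠ j) (σ : Fin m → Bool) :
    flipAt j σ k = σ k :=
  Function.update_of_ne h _ _

lemma sum_eq_zero_of_flipAt {m : ℕ} (j : Fin m) {f : (Fin m → Bool) → ℝ}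
    (hf : ∀ σ, f (flipAt j σ) = -f σ) : ∑ σ, f σ = 0 := by
  have h := Equiv.sum_comp (flipAt j) f
  simp only [hf, Finset.sum_neg_distrib] at h
  linarith

lemma bddAbove_range_of_abs_le {ι : Type*} {f : ι → ℝ} {C : ℝ} (h : ∀ i, |f i| ≤ C) :
    BddAbove (range f) := ⟨C, by
  rintro _ ⟨i, rfl⟩
  exact (le_abs_self _).trans (h i)⟩

lemma abs_ciSup_le {ι : Type*} [Nonempty ι] {f : ι → ℝ} {C : ℝ} (h : ∀ i, |f i| ≤ C) :
    |⨆ i, f i| ≤ C := by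
  obtain ⟨i⟩ := ‹Nonempty ι›
  have : Nonempty ι := ⟨i⟩
  refine abs_le.2 ⟨?_, ciSup_le fun j => (abs_le.1 (h j)).2⟩
  exact (abs_le.1 (h i)).1.trans (le_ciSup (bddAbove_range_of_abs_le h) i)

lemma abs_sum_boolSign_mul_le {m : ℕ} (σ : Fin m → Bool) {w : Fin m → ℝ} {B : ℝ}
    (h : ∀ k, |w k| ≤ B) : |∑ k, boolSign (σ k) * w k| ≤ m * B := by
  refine (Finset.abs_sum_le_sum_abs _ _).trans ?_
  calc ∑ k, |boolSign (σ k) * w k| ≤ ∑ _k : Fin m, B :=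
        Finset.sum_le_sum fun k _ => by rw [abs_mul, abs_boolSign, one_mul]; exact h k
    _ = m * B := by simp

lemma abs_radSum_le {m : ℕ} (σ : Fin m → Bool) {w : Fin m → ℝ} {B : ℝ}
    (h : ∀ k, |w k| ≤ B) : |radSum σ w| ≤ (m : ℝ)⁻¹ * (m * B) := by
  rw [radSum, abs_mul, abs_of_nonneg (by positivity : (0 : ℝ) ≤ (m : ℝ)⁻¹)]
  gcongr
  exact abs_sum_boolSign_mul_le σ h

lemma ciSup_add_ciSup_sub_le {ι : Type*} [Nonempty ι] {A p q : ι → ℝ}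
    (h₁ : BddAbove (range fun i => A i + q i)) (h₂ : BddAbove (range fun i => A i - q i))
    (hpq : ∀ i j, |p i - p j| ≤ |q i - q j|) :
    (⨆ i, (A i + p i)) + (⨆ i, (A i - p i)) ≤ (⨆ i, (A i + q i)) + ⨆ i, (A i - q i) := by
  rw [← le_sub_iff_add_le]
  refine ciSup_le fun i => ?_
  rw [le_sub_comm]
  refine ciSup_le fun j => ?_
  have a₁ := le_ciSup h₁ i
  have a₂ := le_ciSup h₂ j
  have a₃ := le_ciSup h₁ j
  have a₄ := le_ciSup h₂ i
  have := (le_abs_self _).trans (hpq i j)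
  rcases abs_cases (q i - q j) with ⟨h, -⟩ | ⟨h, -⟩ <;> linarith

/-- Replacing one coordinate of a family by a contraction of it decreases the Rademacher
average. -/
lemma sum_ciSup_update_le {ι : Type*} [Nonempty ι] {m : ℕ} (j : Fin m) {v w : ι → Fin m → ℝ}
    {B : ℝ} (hw : ∀ i k, |w i k| ≤ B) (heq : ∀ i, ∀ k ≠ j, v i k = w i k)
    (hj : ∀ i i', |v i j - v i' j| ≤ |w i j - w i' j|) :
    ∑ σ : Fin m → Bool, ⨆ i, ∑ k, boolSign (σ k) * v i k
      ≤ ∑ σ : Fin m → Bool, ⨆ i, ∑ k, boolSign (σ k) * w i k := by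
  have split : ∀ (u : Fin m → ℝ) (σ : Fin m → Bool), ∑ k, boolSign (σ k) * u k =
      ∑ k ∈ Finset.univ.erase j, boolSign (σ k) * u k + boolSign (σ j) * u j := fun u σ => by
    rw [Finset.sum_erase_add _ _ (Finset.mem_univ j)]
  have sum_flipAt : ∀ (u : Fin m → ℝ) (σ : Fin m → Bool), ∑ k, boolSign (flipAt j σ k) * u k =
      ∑ k ∈ Finset.univ.erase j, boolSign (σ k) * u k - boolSign (σ j) * u j := fun u σ => by
    rw [split, flipAt_same, boolSign_not, neg_mul, ← sub_eq_add_neg]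
    congr 1
    refine Finset.sum_congr rfl fun k hk => ?_
    rw [flipAt_of_ne (Finset.ne_of_mem_erase hk)]
  have two : ∀ f : (Fin m → Bool) → ℝ, 2 * ∑ σ, f σ = ∑ σ, (f σ + f (flipAt j σ)) := fun f => by
    rw [Finset.sum_add_distrib, Equiv.sum_comp (flipAt j) f]
    ring
  have hA : ∀ (i : ι) (σ : Fin m → Bool), ∑ k ∈ Finset.univ.erase j, boolSign (σ k) * v i k =
      ∑ k ∈ Finset.univ.erase j, boolSign (σ k) * w i k := fun i σ =>
    Finset.sum_congr rfl fun k hk => by rw [heq i k (Finset.ne_of_mem_erase hk)]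
  refine le_of_mul_le_mul_left ?_ (zero_lt_two (α := ℝ))
  rw [two, two]
  refine Finset.sum_le_sum fun σ _ => ?_
  have b₁ := bddAbove_range_of_abs_le fun i => abs_sum_boolSign_mul_le σ (hw i)
  have b₂ := bddAbove_range_of_abs_le fun i => abs_sum_boolSign_mul_le (flipAt j σ) (hw i)
  simp only [sum_flipAt] at b₂ ⊢
  simp only [split] at b₁ ⊢
  simp only [hA]
  refine ciSup_add_ciSup_sub_le b₁ b₂ fun i i' => ?_
  rw [← mul_sub, ← mul_sub, abs_mul, abs_mul, abs_boolSign, one_mul, one_mul]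
  exact hj i i'

/-- **Talagrand's contraction lemma.** -/
lemma famRad_comp_le {ι : Type*} [Nonempty ι] {m : ℕ} {w : ι → Fin m → ℝ} {B : ℝ}
    (hw : ∀ i k, |w i k| ≤ B) {κ : ℝ≥0} {ψ : ℝ → ℝ} (hψ : LipschitzWith κ ψ) :
    famRad (fun i k => ψ (w i k)) ≤ κ * famRad w := by
  have hψ' : ∀ x y, |ψ x - ψ y| ≤ κ * |x - y| := fun x y => by
    simpa [Real.dist_eq] using hψ.dist_le_mul x y
  have hB : ∀ i k, |ψ (w i k)| ≤ |ψ 0| + κ * B := fun i k => by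
    have h₁ := hψ' (w i k) 0
    rw [sub_zero] at h₁
    have h₂ : κ * |w i k| ≤ κ * B := by gcongr; exact hw i k
    have h₃ := abs_sub_abs_le_abs_sub (ψ (w i k)) (ψ 0)
    linarith
  have key : ∀ s : Finset (Fin m),
      ∑ σ : Fin m → Bool, ⨆ i, ∑ k, boolSign (σ k) * (if k ∈ s then ψ (w i k) else κ * w i k)
        ≤ ∑ σ : Fin m → Bool, ⨆ i, ∑ k, boolSign (σ k) * (κ * w i k) := by
    intro s
    induction s using Finset.induction_on with
    | empty => simp
    | insert j s hjs ih =>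
      refine le_trans (sum_ciSup_update_le j (B := max (|ψ 0| + κ * B) (κ * B)) ?_ ?_ ?_) ih
      · intro i k
        split_ifs
        · exact (hB i k).trans (le_max_left _ _)
        · rw [abs_mul, NNReal.abs_eq]
          refine le_trans ?_ (le_max_right _ _)
          gcongr
          exact hw i k
      · intro i k hk
        simp [hk]
      · intro i i'
        simp only [Finset.mem_insert_self, if_true, hjs, if_false]
        rw [← mul_sub, abs_mul, NNReal.abs_eq]
        exact hψ' _ _
  have h := key Finset.univ
  simp only [Finset.mem_univ, if_true] at h
  have hm : (0 : ℝ) ≤ (m : ℝ)⁻¹ := by positivity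
  simp only [mul_left_comm _ (κ : ℝ), ← Finset.mul_sum,
    ← Real.mul_iSup_of_nonneg (NNReal.coe_nonneg κ)] at h
  simp only [famRad, radSum, ← Real.mul_iSup_of_nonneg hm, ← Finset.mul_sum]
  calc _ ≤ (2 ^ m : ℝ)⁻¹ * ((m : ℝ)⁻¹ *
        (κ * ∑ σ : Fin m → Bool, ⨆ i, ∑ k, boolSign (σ k) * w i k)) := by gcongr
    _ = _ := by ring

lemma sum_radSum {m : ℕ} (w : Fin m → ℝ) : ∑ σ, radSum σ w = 0 := by
  simp only [radSum]
  rw [← Finset.mul_sum, Finset.sum_comm]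
  simp only [← Finset.sum_mul]
  rw [Finset.sum_eq_zero fun k _ => ?_, mul_zero]
  rw [sum_eq_zero_of_flipAt k fun σ => by rw [flipAt_same, boolSign_not], zero_mul]

lemma famRad_nonneg {ι : Type*} [Nonempty ι] {m : ℕ} {w : ι → Fin m → ℝ} {B : ℝ}
    (hw : ∀ i k, |w i k| ≤ B) : 0 ≤ famRad w := by
  obtain ⟨i⟩ := id ‹Nonempty ι›
  refine mul_nonneg (by positivity) ?_
  rw [← sum_radSum (w i)]
  exact Finset.sum_le_sum fun σ _ =>
    le_ciSup (bddAbove_range_of_abs_le fun i => abs_radSum_le σ (hw i)) i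

lemma sum_radSum_one_sq (m : ℕ) :
    ∑ σ : Fin m → Bool, (∑ k, boolSign (σ k)) ^ 2 = 2 ^ m * m := by
  have : ∀ k l : Fin m, ∑ σ : Fin m → Bool, boolSign (σ k) * boolSign (σ l) =
      if k = l then 2 ^ m else 0 := by
    intro k l
    split_ifs with h
    · subst h
      simp [boolSign_mul_self]
    · refine sum_eq_zero_of_flipAt k fun σ => ?_
      rw [flipAt_same, flipAt_of_ne (Ne.symm h), boolSign_not, neg_mul]
  simp_rw [sq, Finset.sum_mul_sum]
  rw [Finset.sum_comm]
  simp_rw [fun k : Fin m => Finset.sum_comm (s := (Finset.univ : Finset (Fin m → Bool)))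
    (t := Finset.univ) (f := fun σ l => boolSign (σ k) * boolSign (σ l)), this]
  simp [mul_comm]

lemma sum_abs_radSum_one_le {m : ℕ} (hm : 0 < m) :
    (2 ^ m : ℝ)⁻¹ * ∑ σ : Fin m → Bool, |radSum σ fun _ => 1| ≤ 1 / Real.sqrt m := by
  have hm' : (0 : ℝ) < m := by exact_mod_cast hm
  have hsq : (∑ σ : Fin m → Bool, |∑ k, boolSign (σ k)|) ^ 2 ≤ (2 ^ m * Real.sqrt m) ^ 2 := by
    refine (sq_sum_le_card_mul_sum_sq (s := (Finset.univ : Finset (Fin m → Bool)))).trans ?_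
    simp only [sq_abs, sum_radSum_one_sq]
    rw [mul_pow, Real.sq_sqrt hm'.le]
    simp
    apply le_of_eq
    ring
  have h := (sq_le_sq₀ (Finset.sum_nonneg fun _ _ => abs_nonneg _) (by positivity)).1 hsq
  simp only [radSum, mul_one, abs_mul, abs_of_pos (inv_pos.2 hm'), ← Finset.mul_sum]
  calc (2 ^ m : ℝ)⁻¹ * ((m : ℝ)⁻¹ * ∑ σ : Fin m → Bool, |∑ k, boolSign (σ k)|)
      ≤ (2 ^ m : ℝ)⁻¹ * ((m : ℝ)⁻¹ * (2 ^ m * Real.sqrt m)) := by gcongr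
    _ = (m : ℝ)⁻¹ * Real.sqrt m := by field_simp
    _ = 1 / Real.sqrt m := by
      rw [inv_mul_eq_div, Real.sqrt_div_self']

/-- Rademacher average of a family shifted by constants from an interval of radius `r`. -/
lemma famRad_sub_le {ι κ : Type*} [Nonempty ι] [Nonempty κ] {m : ℕ} (hm : 0 < m)
    {w : ι → Fin m → ℝ} {B : ℝ} (hw : ∀ i k, |w i k| ≤ B) {s : κ → ℝ} {c r : ℝ}
    (hs : ∀ ν, |s ν - c| ≤ r) :
    famRad (fun (p : ι × κ) k => w p.1 k - s p.2) ≤ famRad w + r / Real.sqrt m := by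
  have hr : 0 ≤ r := (abs_nonneg _).trans (hs (Classical.arbitrary κ))
  have key : ∀ σ : Fin m → Bool, (⨆ p : ι × κ, radSum σ fun k => w p.1 k - s p.2) ≤
      (⨆ i, radSum σ (w i)) + (radSum σ (fun _ => -c) + r * |radSum σ fun _ => 1|) := by
    intro σ
    refine ciSup_le fun p => ?_
    have h₁ : radSum σ (fun k => w p.1 k - s p.2) =
        radSum σ (w p.1) + (radSum σ (fun _ => -c) + (c - s p.2) * radSum σ fun _ => 1) := by
      simp only [radSum, mul_sub, mul_one, Finset.sum_sub_distrib, ← Finset.sum_mul]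
      ring
    rw [h₁]
    refine add_le_add ?_ (add_le_add le_rfl ?_)
    · exact le_ciSup (bddAbove_range_of_abs_le fun i => abs_radSum_le σ (hw i)) p.1
    · refine (le_abs_self _).trans ?_
      rw [abs_mul, abs_sub_comm]
      gcongr
      exact hs _
  calc famRad (fun (p : ι × κ) k => w p.1 k - s p.2)
      ≤ (2 ^ m : ℝ)⁻¹ * ∑ σ : Fin m → Bool, ((⨆ i, radSum σ (w i)) +
        (radSum σ (fun _ => -c) + r * |radSum σ fun _ => 1|)) := by
        rw [famRad]
        gcongr with σ
        exact key σ
    _ = famRad w + r * ((2 ^ m : ℝ)⁻¹ * ∑ σ : Fin m → Bool, |radSum σ fun _ => 1|) := by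
        rw [Finset.sum_add_distrib, Finset.sum_add_distrib, sum_radSum, ← Finset.mul_sum, famRad]
        ring
    _ ≤ famRad w + r * (1 / Real.sqrt m) := by
        gcongr
        exact sum_abs_radSum_one_le hm
    _ = famRad w + r / Real.sqrt m := by ring

lemma measurable_radSum_comp {X : Type*} [MeasurableSpace X] {m : ℕ} (σ : Fin m → Bool)
    {v : X → ℝ} (hv : Measurable v) :
    Measurable fun x : Fin m → X => radSum σ fun k => v (x k) := by
  unfold radSum
  fun_prop

lemma measurable_ciSup_radSum {X ι : Type*} [MeasurableSpace X] [Countable ι] {m : ℕ}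
    (σ : Fin m → Bool) {v : ι → X → ℝ} (hv : ∀ i, Measurable (v i)) :
    Measurable fun x : Fin m → X => ⨆ i, radSum σ fun k => v i (x k) :=
  Measurable.iSup fun i => measurable_radSum_comp σ (hv i)

lemma integrable_ciSup_radSum {X ι : Type*} [MeasurableSpace X] [Countable ι] [Nonempty ι]
    {m : ℕ} (σ : Fin m → Bool) {v : ι → X → ℝ} (hv : ∀ i, Measurable (v i)) {B : ℝ}
    (hB : ∀ i x, |v i x| ≤ B) (μ : Measure (Fin m → X)) [IsFiniteMeasure μ] :
    Integrable (fun x => ⨆ i, radSum σ fun k => v i (x k)) μ :=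
  Integrable.of_bound (measurable_ciSup_radSum σ hv).aestronglyMeasurable ((m : ℝ)⁻¹ * (m * B))
    (ae_of_all _ fun _ => abs_ciSup_le fun i => abs_radSum_le σ fun _ => hB i _)

lemma integrable_famRad {X ι : Type*} [MeasurableSpace X] [Countable ι] [Nonempty ι]
    {m : ℕ} {v : ι → X → ℝ} (hv : ∀ i, Measurable (v i)) {B : ℝ}
    (hB : ∀ i x, |v i x| ≤ B) (μ : Measure (Fin m → X)) [IsFiniteMeasure μ] :
    Integrable (fun x => famRad fun i (k : Fin m) => v i (x k)) μ :=
  (integrable_finsetSum _ fun σ _ => integrable_ciSup_radSum σ hv hB μ).const_mul _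

lemma integral_pi_eval {X : Type*} [MeasurableSpace X] (P : Measure X) [IsProbabilityMeasure P]
    {m : ℕ} (k : Fin m) {v : X → ℝ} (hv : Measurable v) :
    ∫ x, v (x k) ∂(Measure.pi fun _ : Fin m => P) = ∫ x, v x ∂P := by
  have h := measurePreserving_eval (fun _ : Fin m => P) k
  conv_rhs => rw [← h.map_eq]
  rw [integral_map h.measurable.aemeasurable hv.aestronglyMeasurable]

/-- Supremum of the deviations of the empirical means from the true means. -/
noncomputable def supDev {X ι : Type*} [MeasurableSpace X] (P : Measure X) {m : ℕ}
    (v : ι → X → ℝ) (x : Fin m → X) : ℝ :=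
  ⨆ i, ((m : ℝ)⁻¹ * ∑ k, v i (x k) - ∫ y, v i y ∂P)

lemma abs_mean_le {m : ℕ} {w : Fin m → ℝ} {B : ℝ} (h : ∀ k, |w k| ≤ B) :
    |(m : ℝ)⁻¹ * ∑ k, w k| ≤ (m : ℝ)⁻¹ * (m * B) := by
  simpa [radSum, boolSign] using abs_radSum_le (fun _ => true) h

lemma abs_mean_sub_integral_le {X : Type*} [MeasurableSpace X] (P : Measure X)
    [IsProbabilityMeasure P] {m : ℕ} {v : X → ℝ} {B : ℝ} (hB : ∀ x, |v x| ≤ B)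
    (x : Fin m → X) :
    |(m : ℝ)⁻¹ * ∑ k, v (x k) - ∫ y, v y ∂P| ≤ (m : ℝ)⁻¹ * (m * B) + B := by
  refine (abs_sub _ _).trans (add_le_add (abs_mean_le fun k => hB _) ?_)
  simpa using norm_integral_le_of_norm_le_const (μ := P) (f := v) (C := B)
    (ae_of_all _ fun y => by simpa using hB y)

lemma integrable_supDev {X ι : Type*} [MeasurableSpace X] [Countable ι] [Nonempty ι]
    (P : Measure X) [IsProbabilityMeasure P] {m : ℕ} {v : ι → X → ℝ}
    (hv : ∀ i, Measurable (v i)) {B : ℝ} (hB : ∀ i x, |v i x| ≤ B)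
    (μ : Measure (Fin m → X)) [IsFiniteMeasure μ] :
    Integrable (supDev P v) μ :=
  Integrable.of_bound
    (Measurable.iSup fun i => by have := hv i; fun_prop).aestronglyMeasurable
    ((m : ℝ)⁻¹ * (m * B) + B)
    (ae_of_all _ fun x => abs_ciSup_le fun i => abs_mean_sub_integral_le P (hB i) x)

lemma supDev_le {X ι : Type*} [MeasurableSpace X] (P : Measure X)
    [IsProbabilityMeasure P] {m : ℕ} {v : ι → X → ℝ} {B : ℝ} (hB : ∀ i x, |v i x| ≤ B)
    (x : Fin m → X) (i : ι) :
    (m : ℝ)⁻¹ * ∑ k, v i (x k) - ∫ y, v i y ∂P ≤ supDev P v x :=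
  le_ciSup (f := fun i => (m : ℝ)⁻¹ * ∑ k, v i (x k) - ∫ y, v i y ∂P)
    (bddAbove_range_of_abs_le fun i => abs_mean_sub_integral_le P (hB i) x) i

/-- Symmetrization: the expected supremum of deviations is at most twice the Rademacher
complexity. -/
lemma integral_supDev_le {X ι : Type*} [MeasurableSpace X] [Countable ι] [Nonempty ι]
    (P : Measure X) [IsProbabilityMeasure P] {m : ℕ} (hm : 0 < m) {v : ι → X → ℝ}
    (hv : ∀ i, Measurable (v i)) {B : ℝ} (hB : ∀ i x, |v i x| ≤ B) :
    ∫ x, supDev P v x ∂(Measure.pi fun _ : Fin m => P)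
      ≤ 2 * ∫ x, famRad (fun i (k : Fin m) => v i (x k)) ∂(Measure.pi fun _ : Fin m => P) := by
  set μ := Measure.pi fun _ : Fin m => P with hμ
  have hm' : (m : ℝ) ≠ 0 := by exact_mod_cast hm.ne'
  set u : ι → X × X → ℝ := fun i z => v i z.1 - v i z.2 with hu
  have hum : ∀ i, Measurable (u i) := fun i =>
    ((hv i).comp measurable_fst).sub ((hv i).comp measurable_snd)
  have huB : ∀ i z, |u i z| ≤ B + B := fun i z =>
    (abs_sub _ _).trans (add_le_add (hB _ _) (hB _ _))
  let S : (Fin m → X) × (Fin m → X) → ℝ :=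
    fun z => ⨆ i, radSum (fun _ => true) fun k => u i (z.1 k, z.2 k)
  have hSm : Measurable S := Measurable.iSup fun i => by
    have := hum i
    unfold radSum
    fun_prop
  have hSB : ∀ z, |S z| ≤ (m : ℝ)⁻¹ * (m * (B + B)) := fun z =>
    abs_ciSup_le fun i => abs_radSum_le _ fun k => huB _ _
  have hSi : Integrable S (μ.prod μ) :=
    Integrable.of_bound hSm.aestronglyMeasurable _ (ae_of_all _ hSB)
  have hSx : ∀ x, Integrable (fun y => S (x, y)) μ := fun x =>
    Integrable.of_bound (hSm.comp measurable_prodMk_left).aestronglyMeasurable _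
      (ae_of_all _ fun y => hSB _)
  have hvi : ∀ i (k : Fin m), Integrable (fun y : Fin m → X => v i (y k)) μ := fun i k =>
    Integrable.of_bound ((hv i).comp (measurable_pi_apply k)).aestronglyMeasurable B
      (ae_of_all _ fun y => hB _ _)
  have hsup_le : ∀ x, supDev P v x ≤ ∫ y, S (x, y) ∂μ := by
    intro x
    refine ciSup_le fun i => ?_
    have : (m : ℝ)⁻¹ * ∑ k, v i (x k) - ∫ y, v i y ∂P =
        ∫ y, (m : ℝ)⁻¹ * ∑ k, (v i (x k) - v i (y k)) ∂μ := by
      have hd : ∀ k ∈ (Finset.univ : Finset (Fin m)),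
          Integrable (fun y : Fin m → X => v i (x k) - v i (y k)) μ := fun k _ =>
        (integrable_const _).sub (hvi i k)
      rw [integral_const_mul, integral_finsetSum _ hd]
      have : ∀ k, ∫ y, (v i (x k) - v i (y k)) ∂μ = v i (x k) - ∫ y, v i y ∂P := fun k => by
        rw [integral_sub (integrable_const _) (hvi i k), integral_pi_eval P k (hv i)]
        simp
      simp only [this, Finset.sum_sub_distrib, mul_sub]
      simp [hm']
    rw [this]
    refine integral_mono ((integrable_finsetSum _ fun k _ =>
      (integrable_const _).sub (hvi i k)).const_mul _) (hSx x) fun y => ?_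
    have h := le_ciSup (f := fun i => radSum (fun _ => true) fun k => u i (x k, y k))
      (bddAbove_range_of_abs_le fun i => abs_radSum_le _ fun k => huB _ _) i
    simpa [radSum, boolSign, hu, S] using h
  let T : (Fin m → X × X) → ℝ := fun z => ⨆ i, radSum (fun _ => true) fun k => u i (z k)
  set π := Measure.pi fun _ : Fin m => P.prod P with hπ
  have hTm : Measurable T := measurable_ciSup_radSum _ hum
  have hunswap : ∫ z, S z ∂(μ.prod μ) = ∫ z, T z ∂π := by
    have h := measurePreserving_arrowProdEquivProdArrow X X (Fin m) (fun _ => P) (fun _ => P)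
    rw [hμ, ← h.map_eq, integral_map_equiv]
    rfl
  have hsign_le : ∀ σ : Fin m → Bool, ∫ z, T z ∂π ≤
      (∫ x, (⨆ i, radSum σ fun k => v i (x k)) ∂μ) +
        ∫ x, (⨆ i, radSum (fun k => !σ k) fun k => v i (x k)) ∂μ := by
    intro σ
    have hsw : MeasurePreserving (fun (z : Fin m → X × X) k =>
        (if σ k then id else Prod.swap) (z k)) π π :=
      measurePreserving_pi (fun _ => P.prod P) (fun _ => P.prod P) fun k => by
        by_cases h : σ k
        · simpa [h] using MeasurePreserving.id (P.prod P)
        · simpa [h] using Measure.measurePreserving_swap (μ := P) (ν := P)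
    have hf : MeasurePreserving (fun (z : Fin m → X × X) k => (z k).1) π μ :=
      measurePreserving_pi (fun _ => P.prod P) (fun _ => P) fun k => measurePreserving_fst
    have hs : MeasurePreserving (fun (z : Fin m → X × X) k => (z k).2) π μ :=
      measurePreserving_pi (fun _ => P.prod P) (fun _ => P) fun k => measurePreserving_snd
    have hi₁ : Integrable (fun z => ⨆ i, radSum σ fun k => v i (z k).1) π :=
      hf.integrable_comp_of_integrable (integrable_ciSup_radSum σ hv hB μ)
    have hi₂ : Integrable (fun z => ⨆ i, radSum (fun k => !σ k) fun k => v i (z k).2) π :=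
      hs.integrable_comp_of_integrable (integrable_ciSup_radSum (fun k => !σ k) hv hB μ)
    have e₁ : ∫ x, (⨆ i, radSum σ fun k => v i (x k)) ∂μ =
        ∫ z, (⨆ i, radSum σ fun k => v i (z k).1) ∂π := by
      rw [← hf.map_eq, integral_map hf.measurable.aemeasurable
        (measurable_ciSup_radSum σ hv).aestronglyMeasurable]
    have e₂ : ∫ x, (⨆ i, radSum (fun k => !σ k) fun k => v i (x k)) ∂μ =
        ∫ z, (⨆ i, radSum (fun k => !σ k) fun k => v i (z k).2) ∂π := by
      rw [← hs.map_eq, integral_map hs.measurable.aemeasurable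
        (measurable_ciSup_radSum _ hv).aestronglyMeasurable]
    have e₃ : ∫ z, T z ∂π = ∫ z : Fin m → X × X,
        T (fun k => (if σ k then id else Prod.swap) (z k)) ∂π := by
      conv_lhs => rw [← hsw.map_eq]
      rw [integral_map hsw.measurable.aemeasurable hTm.aestronglyMeasurable]
    rw [e₁, e₂, e₃, ← integral_add hi₁ hi₂]
    refine integral_mono (hsw.integrable_comp_of_integrable
      (integrable_ciSup_radSum _ hum huB π)) (hi₁.add hi₂) fun z => ?_
    refine ciSup_le fun i => ?_
    have h₁ := le_ciSup (f := fun i => radSum σ fun k => v i (z k).1)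
      (bddAbove_range_of_abs_le fun i => abs_radSum_le _ fun k => hB _ _) i
    have h₂ := le_ciSup (f := fun i => radSum (fun k => !σ k) fun k => v i (z k).2)
      (bddAbove_range_of_abs_le fun i => abs_radSum_le _ fun k => hB _ _) i
    refine le_trans (le_of_eq ?_) (add_le_add h₁ h₂)
    simp only [radSum]
    rw [← mul_add, ← Finset.sum_add_distrib]
    congr 1
    refine Finset.sum_congr rfl fun k _ => ?_
    cases h : σ k <;> simp [hu, boolSign] <;> ring
  have hneg : ∀ f : (Fin m → Bool) → ℝ, ∑ σ : Fin m → Bool, f (fun k => !σ k) = ∑ σ, f σ :=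
    fun f =>
    Equiv.sum_comp (Function.Involutive.toPerm (fun (σ : Fin m → Bool) k => !σ k)
      fun σ => by simp) f
  have hmean_le : ∫ z, T z ∂π ≤
      2 * ∫ x, famRad (fun i (k : Fin m) => v i (x k)) ∂μ := by
    have h := Finset.sum_le_sum fun σ (_ : σ ∈ (Finset.univ : Finset (Fin m → Bool))) => hsign_le σ
    rw [Finset.sum_add_distrib,
      hneg fun σ => ∫ x, (⨆ i, radSum σ fun k => v i (x k)) ∂μ] at h
    simp only [famRad]
    rw [integral_const_mul, integral_finsetSum _ fun σ _ => integrable_ciSup_radSum σ hv hB μ]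
    simp only [Finset.sum_const, Finset.card_univ, Fintype.card_fun, Fintype.card_bool,
      Fintype.card_fin, nsmul_eq_mul, Nat.cast_pow, Nat.cast_ofNat] at h
    rw [mul_left_comm, inv_mul_eq_div, le_div_iff₀ (by positivity)]
    linarith
  calc ∫ x, supDev P v x ∂μ ≤ ∫ x, ∫ y, S (x, y) ∂μ ∂μ :=
        integral_mono (integrable_supDev P hv hB μ) hSi.integral_prod_left hsup_le
    _ = ∫ z, T z ∂π := by rw [← integral_prod _ hSi, hunswap]
    _ ≤ _ := hmean_le

/-- Expected deviation for the class of functions `ψ (v i - ν)`. -/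
lemma integral_supDev_comp_sub_le {X ι κ : Type*} [MeasurableSpace X] [Countable ι] [Nonempty ι]
    [Countable κ] [Nonempty κ] (P : Measure X) [IsProbabilityMeasure P] {m : ℕ} (hm : 0 < m)
    {v : ι → X → ℝ} (hv : ∀ i, Measurable (v i)) {B : ℝ} (hB : ∀ i x, |v i x| ≤ B)
    {s : κ → ℝ} {c r : ℝ} (hs : ∀ ν, |s ν - c| ≤ r) {L : ℝ≥0} {ψ : ℝ → ℝ}
    (hψ : LipschitzWith L ψ) {C : ℝ} (hC : ∀ t, |ψ t| ≤ C) :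
    ∫ x, supDev P (fun (p : ι × κ) y => ψ (v p.1 y - s p.2)) x ∂(Measure.pi fun _ : Fin m => P)
      ≤ 2 * (L * ((∫ x, famRad (fun i (k : Fin m) => v i (x k))
        ∂(Measure.pi fun _ : Fin m => P)) + r / Real.sqrt m)) := by
  have hψm : Measurable ψ := hψ.continuous.measurable
  have hmeas : ∀ p : ι × κ, Measurable fun y => ψ (v p.1 y - s p.2) := fun p =>
    hψm.comp ((hv p.1).sub_const _)
  refine (integral_supDev_le P hm hmeas fun p y => hC _).trans ?_
  have hi := integrable_famRad hv hB (Measure.pi fun _ : Fin m => P)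
  have hB' : ∀ (p : ι × κ) (y : X), |v p.1 y - s p.2| ≤ B + (r + |c|) := fun p y => by
    have h₁ := hs p.2
    have h₂ := abs_add_le (s p.2 - c) c
    rw [sub_add_cancel] at h₂
    exact (abs_sub _ _).trans (add_le_add (hB _ _) (h₂.trans (by gcongr)))
  have hpt : ∀ x : Fin m → X, famRad (fun (p : ι × κ) k => ψ (v p.1 (x k) - s p.2)) ≤
      (L : ℝ) * (famRad (fun i (k : Fin m) => v i (x k)) + r / Real.sqrt m) := fun x => by
    have h₁ := famRad_comp_le (w := fun (p : ι × κ) (k : Fin m) => v p.1 (x k) - s p.2)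
      (fun p k => hB' p (x k)) hψ
    have h₂ := famRad_sub_le hm (w := fun i (k : Fin m) => v i (x k))
      (fun i k => hB i (x k)) hs
    exact h₁.trans (mul_le_mul_of_nonneg_left h₂ L.coe_nonneg)
  refine mul_le_mul_of_nonneg_left ?_ zero_le_two
  have hadd : Integrable (fun x => famRad (fun i (k : Fin m) => v i (x k)) + r / Real.sqrt m)
      (Measure.pi fun _ : Fin m => P) := hi.add (integrable_const _)
  refine (integral_mono (integrable_famRad hmeas (fun p y => hC _) _)
    (hadd.const_mul (L : ℝ)) hpt).trans_eq ?_
  rw [integral_const_mul, integral_add hi (integrable_const _)]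
  simp

lemma isOpen_Dom (a : ℝ) (b : EReal) : IsOpen (Dom a b) :=
  isOpen_Ioi.inter (isOpen_Iio.preimage continuous_coe_real_ereal)

section Legendre

variable {f : ℝ → ℝ} {a : ℝ} {b : EReal}

lemma le_fStar {t : ℝ} (ht : t ∈ Dom a b) (z : ℝ) : ((z * t - f t : ℝ) : EReal) ≤ fStar f a b z :=
  le_iSup₂_of_le (f := fun t (_ : t ∈ Dom a b) => ((z * t - f t : ℝ) : EReal)) t ht le_rfl

lemma self_le_fStar (ha1 : a < 1) (hb1 : ((1 : ℝ) : EReal) < b) (hf1 : f 1 = 0) (z : ℝ) :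
    (z : EReal) ≤ fStar f a b z := by
  simpa [hf1] using le_fStar (f := f) (show (1 : ℝ) ∈ Dom a b from ⟨ha1, hb1⟩) z

lemma fStar_ne_bot (ha1 : a < 1) (hb1 : ((1 : ℝ) : EReal) < b) (hf1 : f 1 = 0) (z : ℝ) :
    fStar f a b z ≠ ⊥ :=
  ne_bot_of_le_ne_bot (EReal.coe_ne_bot z) (self_le_fStar ha1 hb1 hf1 z)

lemma fStar_mono (ha0 : 0 ≤ a) : Monotone (fStar f a b) := fun z w hzw =>
  iSup₂_le fun t ht => (EReal.coe_le_coe_iff.2 (by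
    have := mul_le_mul_of_nonneg_right hzw (ha0.trans ht.1.le)
    linarith)).trans (le_fStar ht w)

lemma coe_fStarR (ha1 : a < 1) (hb1 : ((1 : ℝ) : EReal) < b) (hf1 : f 1 = 0) {z : ℝ}
    (hz : fStar f a b z < ⊤) : (fStarR f a b z : EReal) = fStar f a b z :=
  EReal.coe_toReal hz.ne (fStar_ne_bot ha1 hb1 hf1 z)

lemma le_fStarR (ha1 : a < 1) (hb1 : ((1 : ℝ) : EReal) < b) (hf1 : f 1 = 0) {z t : ℝ}
    (hz : fStar f a b z < ⊤) (ht : t ∈ Dom a b) : z * t - f t ≤ fStarR f a b z := by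
  rw [← EReal.coe_le_coe_iff, coe_fStarR ha1 hb1 hf1 hz]
  exact le_fStar ht z

lemma self_le_fStarR (ha1 : a < 1) (hb1 : ((1 : ℝ) : EReal) < b) (hf1 : f 1 = 0) {z : ℝ}
    (hz : fStar f a b z < ⊤) : z ≤ fStarR f a b z := by
  simpa [hf1] using le_fStarR ha1 hb1 hf1 hz ⟨ha1, hb1⟩

lemma monotoneOn_fStarR (ha0 : 0 ≤ a) (ha1 : a < 1) (hb1 : ((1 : ℝ) : EReal) < b)
    (hf1 : f 1 = 0) : MonotoneOn (fStarR f a b) {z | fStar f a b z < ⊤} := fun z hz w hw hzw => by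
  rw [← EReal.coe_le_coe_iff, coe_fStarR ha1 hb1 hf1 hz, coe_fStarR ha1 hb1 hf1 hw]
  exact fStar_mono ha0 hzw

lemma convexOn_fStarR (ha1 : a < 1) (hb1 : ((1 : ℝ) : EReal) < b) (hf1 : f 1 = 0) :
    ConvexOn ℝ {z | fStar f a b z < ⊤} (fStarR f a b) := by
  have key : ∀ x ∈ {z | fStar f a b z < ⊤}, ∀ y ∈ {z | fStar f a b z < ⊤}, ∀ p q : ℝ,
      0 ≤ p → 0 ≤ q → p + q = 1 → fStar f a b (p * x + q * y) ≤
        ((p * fStarR f a b x + q * fStarR f a b y : ℝ) : EReal) := by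
    intro x hx y hy p q hp hq hpq
    refine iSup₂_le fun t ht => EReal.coe_le_coe_iff.2 ?_
    have h₁ := mul_le_mul_of_nonneg_left (le_fStarR ha1 hb1 hf1 hx ht) hp
    have h₂ := mul_le_mul_of_nonneg_left (le_fStarR ha1 hb1 hf1 hy ht) hq
    have h₃ : f t = p * f t + q * f t := by rw [← add_mul, hpq, one_mul]
    linarith
  have hc : Convex ℝ {z | fStar f a b z < ⊤} := fun x hx y hy p q hp hq hpq =>
    (key x hx y hy p q hp hq hpq).trans_lt (EReal.coe_lt_top _)
  refine ⟨hc, fun x hx y hy p q hp hq hpq => ?_⟩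
  rw [← EReal.coe_le_coe_iff, coe_fStarR ha1 hb1 hf1 (hc hx hy hp hq hpq)]
  exact key x hx y hy p q hp hq hpq

lemma fStar_zz (ha1 : a < 1) (hb1 : ((1 : ℝ) : EReal) < b)
    (hconv : ConvexOn ℝ (Dom a b) f) (hf1 : f 1 = 0) : fStar f a b (zz f) = zz f := by
  refine le_antisymm (iSup₂_le fun t ht => EReal.coe_le_coe_iff.2 ?_)
    (self_le_fStar ha1 hb1 hf1 _)
  have h1 : (1 : ℝ) ∈ interior (Dom a b) := by
    rw [(isOpen_Dom a b).interior_eq]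
    exact ⟨ha1, hb1⟩
  have hd : zz f = derivWithin f (Ioi 1) 1 := (derivWithin_Ioi_eq_Ici f 1).symm
  rcases lt_trichotomy t 1 with h | h | h
  · have h₁ := (hconv.slope_le_leftDeriv_of_mem_interior ht h1 h).trans
      (hconv.leftDeriv_le_rightDeriv_of_mem_interior h1)
    rw [← hd, slope_def_field, div_le_iff₀ (by linarith), hf1] at h₁
    linarith
  · simp [h, hf1]
  · have h₁ := hconv.rightDeriv_le_slope_of_mem_interior h1 ht h
    rw [← hd, slope_def_field, le_div_iff₀ (by linarith), hf1] at h₁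
    linarith

lemma fStarR_zz (ha1 : a < 1) (hb1 : ((1 : ℝ) : EReal) < b)
    (hconv : ConvexOn ℝ (Dom a b) f) (hf1 : f 1 = 0) : fStarR f a b (zz f) = zz f := by
  rw [fStarR, fStar_zz ha1 hb1 hconv hf1, EReal.toReal_coe]

/-- The function `f* - id` decreases towards its minimizer `zz f`. -/
lemma fStarR_sub_le_of_mem_uIcc (ha1 : a < 1) (hb1 : ((1 : ℝ) : EReal) < b)
    (hconv : ConvexOn ℝ (Dom a b) f) (hf1 : f 1 = 0) {y z : ℝ} (hz : fStar f a b z < ⊤)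
    (hy : y ∈ uIcc (zz f) z) : fStarR f a b y - y ≤ fStarR f a b z - z := by
  have hz₀ : fStar f a b (zz f) < ⊤ := by
    rw [fStar_zz ha1 hb1 hconv hf1]
    exact EReal.coe_lt_top _
  rw [← segment_eq_uIcc] at hy
  obtain ⟨p, q, hp, hq, hpq, rfl⟩ := hy
  have h := (convexOn_fStarR ha1 hb1 hf1).2 hz₀ hz hp hq hpq
  rw [fStarR_zz ha1 hb1 hconv hf1] at h
  simp only [smul_eq_mul] at h ⊢
  have h₁ := mul_le_mul_of_nonneg_right (show q ≤ 1 by linarith)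
    (sub_nonneg.2 (self_le_fStarR ha1 hb1 hf1 hz))
  linarith

lemma mem_interior_of_le (ha0 : 0 ≤ a) {y z : ℝ} (hyz : y ≤ z)
    (hz : z ∈ interior {z | fStar f a b z < ⊤}) : y ∈ interior {z | fStar f a b z < ⊤} := by
  rw [mem_interior_iff_mem_nhds, Metric.mem_nhds_iff] at hz ⊢
  obtain ⟨δ, hδ, h⟩ := hz
  refine ⟨δ, hδ, fun w hw => ?_⟩
  have hw' : w - y + z ∈ Metric.ball z δ := by
    simpa [Real.dist_eq] using hw
  exact (fStar_mono ha0 (by linarith)).trans_lt (h hw')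

lemma fStar_lt_top_of_mem {z : ℝ} (hz : z ∈ interior {z | fStar f a b z < ⊤}) :
    fStar f a b z < ⊤ := by
  have h : z ∈ {z | fStar f a b z < ⊤} := interior_subset hz
  exact h

lemma rderiv_eq (g : ℝ → ℝ) (z : ℝ) : rderiv g z = derivWithin g (Ioi z) z :=
  (derivWithin_Ioi_eq_Ici g z).symm

lemma fStarR_sub_le_rderiv_mul (ha1 : a < 1) (hb1 : ((1 : ℝ) : EReal) < b) (hf1 : f 1 = 0)
    {x y : ℝ} (hx : fStar f a b x < ⊤) (hy : y ∈ interior {z | fStar f a b z < ⊤})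
    (hxy : x ≤ y) : fStarR f a b y - fStarR f a b x ≤ rderiv (fStarR f a b) y * (y - x) := by
  rcases hxy.eq_or_lt with rfl | h
  · simp
  have hc := convexOn_fStarR ha1 hb1 hf1
  have h₁ := (hc.slope_le_leftDeriv_of_mem_interior hx hy h).trans
    (hc.leftDeriv_le_rightDeriv_of_mem_interior hy)
  rwa [← rderiv_eq, slope_def_field, div_le_iff₀ (by linarith)] at h₁

lemma rderiv_mul_le_fStarR_sub (ha1 : a < 1) (hb1 : ((1 : ℝ) : EReal) < b) (hf1 : f 1 = 0)
    {x y : ℝ} (hx : x ∈ interior {z | fStar f a b z < ⊤}) (hy : fStar f a b y < ⊤)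
    (hxy : x ≤ y) : rderiv (fStarR f a b) x * (y - x) ≤ fStarR f a b y - fStarR f a b x := by
  rcases hxy.eq_or_lt with rfl | h
  · simp
  have h₁ := (convexOn_fStarR ha1 hb1 hf1).rightDeriv_le_slope_of_mem_interior hx hy h
  rwa [← rderiv_eq, slope_def_field, le_div_iff₀ (by linarith)] at h₁

lemma rderiv_fStarR_mono (ha1 : a < 1) (hb1 : ((1 : ℝ) : EReal) < b) (hf1 : f 1 = 0)
    {x y : ℝ} (hx : x ∈ interior {z | fStar f a b z < ⊤})
    (hy : y ∈ interior {z | fStar f a b z < ⊤}) (hxy : x ≤ y) :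
    rderiv (fStarR f a b) x ≤ rderiv (fStarR f a b) y := by
  rw [rderiv_eq, rderiv_eq]
  exact (convexOn_fStarR ha1 hb1 hf1).monotoneOn_rightDeriv hx hy hxy

lemma rderiv_fStarR_nonneg (ha0 : 0 ≤ a) (ha1 : a < 1) (hb1 : ((1 : ℝ) : EReal) < b)
    (hf1 : f 1 = 0) {z : ℝ} (hz : z ∈ interior {z | fStar f a b z < ⊤}) :
    0 ≤ rderiv (fStarR f a b) z := by
  have hz' := fStar_lt_top_of_mem (mem_interior_of_le ha0 (show z - 1 ≤ z by linarith) hz)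
  have h₁ := fStarR_sub_le_rderiv_mul ha1 hb1 hf1 hz' hz (by linarith)
  have h₂ := monotoneOn_fStarR ha0 ha1 hb1 hf1 hz' (fStar_lt_top_of_mem hz) (by linarith)
  linarith

/-- Clamping a real number to the interval `[l, u]`. -/
def clamp (l u x : ℝ) : ℝ := max l (min u x)

lemma clamp_mem {l u : ℝ} (h : l ≤ u) (x : ℝ) : clamp l u x ∈ Icc l u :=
  ⟨le_max_left _ _, max_le h (min_le_left _ _)⟩

lemma clamp_of_mem {l u x : ℝ} (h : x ∈ Icc l u) : clamp l u x = x := by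
  rw [clamp, min_eq_right h.2, max_eq_right h.1]

lemma lipschitzWith_clamp (l u : ℝ) : LipschitzWith 1 (clamp l u) :=
  (LipschitzWith.id.const_min u).const_max l

lemma continuous_clamp (l u : ℝ) : Continuous (clamp l u) := (lipschitzWith_clamp l u).continuous

lemma lipschitzWith_comp_clamp {l u : ℝ} (h : l ≤ u) {φ : ℝ → ℝ} {κ : ℝ≥0}
    (hφ : ∀ x ∈ Icc l u, ∀ y ∈ Icc l u, x ≤ y → |φ y - φ x| ≤ κ * (y - x)) :
    LipschitzWith κ fun x => φ (clamp l u x) := by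
  have hL : LipschitzOnWith κ φ (Icc l u) := LipschitzOnWith.of_dist_le_mul fun x hx y hy => by
    rw [Real.dist_eq, Real.dist_eq]
    rcases le_total x y with hxy | hxy
    · rw [abs_sub_comm, abs_sub_comm x y, abs_of_nonneg (sub_nonneg.2 hxy)]
      exact hφ x hx y hy hxy
    · rw [abs_of_nonneg (sub_nonneg.2 hxy)]
      exact hφ y hy x hx hxy
  have := hL.comp (lipschitzWith_clamp l u).lipschitzOnWith (s := univ)
    (fun x _ => clamp_mem h x)
  rw [mul_one] at this
  exact lipschitzOnWith_univ.1 this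

lemma lipschitzWith_fStarR_clamp (ha0 : 0 ≤ a) (ha1 : a < 1) (hb1 : ((1 : ℝ) : EReal) < b)
    (hf1 : f 1 = 0) {l u : ℝ} (hlu : l ≤ u) (hu : u ∈ interior {z | fStar f a b z < ⊤}) :
    LipschitzWith (rderiv (fStarR f a b) u).toNNReal fun x => fStarR f a b (clamp l u x) := by
  refine lipschitzWith_comp_clamp hlu fun x hx y hy hxy => ?_
  have hx' := mem_interior_of_le ha0 hx.2 hu
  have hy' := mem_interior_of_le ha0 hy.2 hu
  rw [Real.coe_toNNReal _ (rderiv_fStarR_nonneg ha0 ha1 hb1 hf1 hu), abs_of_nonneg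
    (sub_nonneg.2 (monotoneOn_fStarR ha0 ha1 hb1 hf1 (fStar_lt_top_of_mem hx')
      (fStar_lt_top_of_mem hy') hxy))]
  refine (fStarR_sub_le_rderiv_mul ha1 hb1 hf1 (fStar_lt_top_of_mem hx') hy' hxy).trans ?_
  exact mul_le_mul_of_nonneg_right (rderiv_fStarR_mono ha1 hb1 hf1 hy' hu hy.2)
    (sub_nonneg.2 hxy)

lemma rderiv_fStarR_zz (ha0 : 0 ≤ a) (ha1 : a < 1) (hb1 : ((1 : ℝ) : EReal) < b)
    (hconv : ConvexOn ℝ (Dom a b) f) (hf1 : f 1 = 0) {D : ℝ} (hD : 0 < D)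
    (hz : zz f + D ∈ interior {z | fStar f a b z < ⊤}) {L : ℝ≥0}
    (hL : LipschitzOnWith L (rderiv (fStarR f a b)) (Icc (zz f - D) (zz f + D))) :
    rderiv (fStarR f a b) (zz f) = 1 := by
  have h₀ := mem_interior_of_le ha0 (show zz f ≤ zz f + D by linarith) hz
  refine le_antisymm (le_of_forall_pos_le_add fun ε hε => ?_) ?_
  · set η := min D (ε / (L + 1)) with hη
    have hη0 : 0 < η := lt_min hD (by positivity)
    have hηD : η ≤ D := min_le_left _ _
    have hx := mem_interior_of_le ha0 (show zz f - η ≤ zz f + D by linarith) hz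
    have h₁ := rderiv_mul_le_fStarR_sub ha1 hb1 hf1 hx (fStar_lt_top_of_mem h₀) (by linarith)
    have h₂ := self_le_fStarR ha1 hb1 hf1 (fStar_lt_top_of_mem hx)
    rw [fStarR_zz ha1 hb1 hconv hf1] at h₁
    have h₃ : rderiv (fStarR f a b) (zz f - η) ≤ 1 := by
      by_contra! h
      have := mul_lt_mul_of_pos_right h hη0
      rw [sub_sub_cancel] at h₁
      linarith
    have h₄ := hL.dist_le_mul (zz f) ⟨by linarith, by linarith⟩ (zz f - η)
      ⟨by linarith, by linarith⟩
    rw [Real.dist_eq, Real.dist_eq, sub_sub_cancel, abs_of_pos hη0] at h₄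
    have h₅ : L * η ≤ ε := by
      have h₆ : η ≤ ε / (L + 1) := min_le_right _ _
      rw [le_div_iff₀ (by positivity)] at h₆
      linarith
    linarith [le_abs_self (rderiv (fStarR f a b) (zz f) - rderiv (fStarR f a b) (zz f - η))]
  · rw [rderiv_eq, (convexOn_fStarR ha1 hb1 hf1).rightDeriv_eq_sInf_slope_of_mem_interior h₀]
    refine le_csInf ?_ ?_
    · exact ⟨_, zz f + D, ⟨fStar_lt_top_of_mem hz, by simpa using hD⟩, rfl⟩
    · rintro _ ⟨y, ⟨hy, hy'⟩, rfl⟩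
      rw [slope_def_field, le_div_iff₀ (sub_pos.2 hy'), fStarR_zz ha1 hb1 hconv hf1]
      linarith [self_le_fStarR ha1 hb1 hf1 hy]

lemma lipschitzWith_fStarR_clamp_sub (ha0 : 0 ≤ a) (ha1 : a < 1) (hb1 : ((1 : ℝ) : EReal) < b)
    (hconv : ConvexOn ℝ (Dom a b) f) (hf1 : f 1 = 0) {D : ℝ≥0} (hD : 0 < D)
    (hz : zz f + D ∈ interior {z | fStar f a b z < ⊤}) {L : ℝ≥0}
    (hL : LipschitzOnWith L (rderiv (fStarR f a b)) (Icc (zz f - D) (zz f + D))) :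
    LipschitzWith (L * D) fun x => fStarR f a b (clamp (zz f - D) (zz f + D) x)
      - clamp (zz f - D) (zz f + D) x := by
  have hD' : (0 : ℝ) < D := hD
  refine lipschitzWith_comp_clamp (φ := fun x => fStarR f a b x - x) (by linarith)
    fun x hx y hy hxy => ?_
  have hd : ∀ t ∈ Icc (zz f - (D : ℝ)) (zz f + D), |rderiv (fStarR f a b) t - 1| ≤ L * D := by
    intro t ht
    have h := hL.dist_le_mul t ht (zz f) ⟨by linarith, by linarith⟩
    rw [Real.dist_eq, Real.dist_eq, rderiv_fStarR_zz ha0 ha1 hb1 hconv hf1 hD' hz hL] at h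
    refine h.trans (mul_le_mul_of_nonneg_left ?_ L.coe_nonneg)
    rw [abs_le]
    constructor <;> linarith [ht.1, ht.2]
  have hx' := mem_interior_of_le ha0 hx.2 hz
  have hy' := mem_interior_of_le ha0 hy.2 hz
  have h₁ := fStarR_sub_le_rderiv_mul ha1 hb1 hf1 (fStar_lt_top_of_mem hx') hy' hxy
  have h₂ := rderiv_mul_le_fStarR_sub ha1 hb1 hf1 hx' (fStar_lt_top_of_mem hy') hxy
  have hxy' := sub_nonneg.2 hxy
  have h₃ := mul_le_mul_of_nonneg_right (abs_le.1 (hd y hy)).2 hxy'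
  have h₄ := mul_le_mul_of_nonneg_right (abs_le.1 (hd x hx)).1 hxy'
  rw [NNReal.coe_mul, abs_le]
  constructor <;> linarith

end Legendre

section EmpiricalMeasure

variable {X : Type*} [MeasurableSpace X]

lemma isProbabilityMeasure_empMeas {m : ℕ} (hm : 0 < m) (xs : Fin m → X) :
    IsProbabilityMeasure (empMeas m xs) := by
  refine ⟨?_⟩
  simp only [empMeas, Measure.smul_apply, Measure.finsetSum_apply, measure_univ, Finset.sum_const,
    Finset.card_univ, Fintype.card_fin, nsmul_eq_mul, mul_one, smul_eq_mul]
  exact ENNReal.inv_mul_cancel (by exact_mod_cast hm.ne') (ENNReal.natCast_ne_top m)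

lemma integral_empMeas {m : ℕ} (xs : Fin m → X) {g : X → ℝ} (hg : Measurable g) :
    ∫ x, g x ∂(empMeas m xs) = (m : ℝ)⁻¹ * ∑ k, g (xs k) := by
  rw [empMeas, integral_smul_measure, integral_finsetSum_measure fun i _ =>
    integrable_dirac' hg.stronglyMeasurable (by simp)]
  simp [integral_dirac' _ _ hg.stronglyMeasurable]

end EmpiricalMeasure

section Cumulant

variable {f : ℝ → ℝ} {a : ℝ} {b : EReal} {α β : ℝ}

/-- The Legendre transform, frozen outside the `r`-neighbourhood of `zz f`. -/
noncomputable def fStarCut (f : ℝ → ℝ) (a : ℝ) (b : EReal) (r t : ℝ) : ℝ :=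
  fStarR f a b (clamp (zz f - r) (zz f + r) t)

/-- Restriction of the shift parameter to the range where the infimum is attained. -/
noncomputable def shiftCut (f : ℝ → ℝ) (α β ν : ℝ) : ℝ := clamp (α - zz f) (β - zz f) ν

lemma shiftCut_mem (hαβ : α < β) (ν : ℝ) :
    shiftCut f α β ν ∈ Icc (α - zz f) (β - zz f) :=
  clamp_mem (by linarith) ν

lemma sub_shiftCut_mem (hαβ : α < β) (ν : ℝ) {x : ℝ} (hx : x ∈ Icc α β) :
    x - shiftCut f α β ν ∈ Icc (zz f - (β - α)) (zz f + (β - α)) := by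
  have h := shiftCut_mem (f := f) hαβ ν
  constructor <;> linarith [h.1, h.2, hx.1, hx.2]

lemma sub_shiftCut_mem_uIcc (hαβ : α < β) (ν : ℝ) {x : ℝ} (hx : x ∈ Icc α β) :
    x - shiftCut f α β ν ∈ uIcc (zz f) (x - ν) := by
  have h₁ := hx.1
  have h₂ := hx.2
  rw [mem_uIcc]
  unfold shiftCut clamp
  rcases le_total ν (α - zz f) with h | h
  · rw [max_eq_left ((min_le_right _ _).trans h)]
    left; constructor <;> linarith
  · rcases le_total ν (β - zz f) with h' | h'
    · rw [min_eq_right h', max_eq_right h]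
      rcases le_total (zz f) (x - ν) with h'' | h''
      · exact Or.inl ⟨h'', le_rfl⟩
      · exact Or.inr ⟨le_rfl, h''⟩
    · rw [min_eq_left h', max_eq_right (by linarith)]
      right; constructor <;> linarith

lemma fStarCut_sub_shiftCut (hαβ : α < β) (ν : ℝ) {x : ℝ} (hx : x ∈ Icc α β) :
    fStarCut f a b (β - α) (x - shiftCut f α β ν) = fStarR f a b (x - shiftCut f α β ν) := by
  rw [fStarCut, clamp_of_mem (sub_shiftCut_mem hαβ ν hx)]

lemma shiftCut_add_fStarCut_le (ha1 : a < 1) (hb1 : ((1 : ℝ) : EReal) < b)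
    (hconv : ConvexOn ℝ (Dom a b) f) (hf1 : f 1 = 0) (hαβ : α < β) (ν : ℝ) {x : ℝ}
    (hx : x ∈ Icc α β) (hν : fStar f a b (x - ν) < ⊤) :
    shiftCut f α β ν + fStarCut f a b (β - α) (x - shiftCut f α β ν)
      ≤ ν + fStarR f a b (x - ν) := by
  rw [fStarCut_sub_shiftCut hαβ ν hx]
  linarith [fStarR_sub_le_of_mem_uIcc ha1 hb1 hconv hf1 hν (sub_shiftCut_mem_uIcc hαβ ν hx)]

lemma lipschitzWith_fStarCut (ha0 : 0 ≤ a) (ha1 : a < 1) (hb1 : ((1 : ℝ) : EReal) < b)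
    (hf1 : f 1 = 0) {r : ℝ} (hr : 0 < r)
    (hz : zz f + r ∈ interior {z | fStar f a b z < ⊤}) :
    LipschitzWith (rderiv (fStarR f a b) (zz f + r)).toNNReal (fStarCut f a b r) :=
  lipschitzWith_fStarR_clamp ha0 ha1 hb1 hf1 (by linarith) hz

lemma clamp_lt_top (ha0 : 0 ≤ a) {r : ℝ} (hr : 0 < r)
    (hz : zz f + r ∈ interior {z | fStar f a b z < ⊤}) (t : ℝ) :
    fStar f a b (clamp (zz f - r) (zz f + r) t) < ⊤ :=
  (fStar_mono ha0 (clamp_mem (by linarith) t).2).trans_lt (fStar_lt_top_of_mem hz)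

lemma abs_fStarCut_le (ha0 : 0 ≤ a) (ha1 : a < 1) (hb1 : ((1 : ℝ) : EReal) < b)
    (hf1 : f 1 = 0) {r : ℝ} (hr : 0 < r)
    (hz : zz f + r ∈ interior {z | fStar f a b z < ⊤}) (t : ℝ) :
    |fStarCut f a b r t| ≤ max |fStarR f a b (zz f - r)| |fStarR f a b (zz f + r)| := by
  have h := clamp_mem (show zz f - r ≤ zz f + r by linarith) t
  have hl : fStar f a b (zz f - r) < ⊤ :=
    fStar_lt_top_of_mem (mem_interior_of_le ha0 (by linarith) hz)
  exact abs_le_max_abs_abs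
    (monotoneOn_fStarR ha0 ha1 hb1 hf1 hl (clamp_lt_top ha0 hr hz t) h.1)
    (monotoneOn_fStarR ha0 ha1 hb1 hf1 (clamp_lt_top ha0 hr hz t) (fStar_lt_top_of_mem hz) h.2)

variable {X : Type*} [MeasurableSpace X]

/-- The objective in the variational formula for the cumulant generating function, with the
shift restricted to a compact interval. -/
noncomputable def cgfObj (f : ℝ → ℝ) (a : ℝ) (b : EReal) (α β : ℝ) (P : Measure X)
    (h : X → ℝ) (ν : ℝ) : ℝ :=
  shiftCut f α β ν + ∫ x, fStarCut f a b (β - α) (h x - shiftCut f α β ν) ∂P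

lemma continuous_cgfObj (ha0 : 0 ≤ a) (ha1 : a < 1) (hb1 : ((1 : ℝ) : EReal) < b)
    (hf1 : f 1 = 0) (hαβ : α < β) (hz : zz f + (β - α) ∈ interior {z | fStar f a b z < ⊤})
    (P : Measure X) [IsProbabilityMeasure P] {h : X → ℝ} (hh : Measurable h) :
    Continuous (cgfObj f a b α β P h) := by
  have hr := sub_pos.2 hαβ
  have hc := (lipschitzWith_fStarCut ha0 ha1 hb1 hf1 hr hz).continuous
  have hs : Continuous (shiftCut f α β) := continuous_clamp _ _
  refine hs.add (continuous_of_dominated (bound := fun _ =>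
    max |fStarR f a b (zz f - (β - α))| |fStarR f a b (zz f + (β - α))|) (fun ν => ?_)
    (fun ν => ae_of_all _ fun x => abs_fStarCut_le ha0 ha1 hb1 hf1 hr hz _)
    (integrable_const _) (ae_of_all _ fun x => by fun_prop))
  exact (hc.measurable.comp (hh.sub_const _)).aestronglyMeasurable

lemma integrable_fStarCut (ha0 : 0 ≤ a) (ha1 : a < 1) (hb1 : ((1 : ℝ) : EReal) < b)
    (hf1 : f 1 = 0) {r : ℝ} (hr : 0 < r) (hz : zz f + r ∈ interior {z | fStar f a b z < ⊤})
    (P : Measure X) [IsProbabilityMeasure P] {h : X → ℝ} (hh : Measurable h) (ν : ℝ) :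
    Integrable (fun x => fStarCut f a b r (h x - ν)) P :=
  Integrable.of_bound (((lipschitzWith_fStarCut ha0 ha1 hb1 hf1 hr hz).continuous.measurable.comp
    (hh.sub_const _)).aestronglyMeasurable) _
    (ae_of_all _ fun _ => abs_fStarCut_le ha0 ha1 hb1 hf1 hr hz _)

lemma le_cgfObj (ha0 : 0 ≤ a) (ha1 : a < 1) (hb1 : ((1 : ℝ) : EReal) < b)
    (hf1 : f 1 = 0) (hαβ : α < β) (hz : zz f + (β - α) ∈ interior {z | fStar f a b z < ⊤})
    (P : Measure X) [IsProbabilityMeasure P] {h : X → ℝ} (hh : Measurable h)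
    (hb : ∀ x, h x ∈ Icc α β) (ν : ℝ) : α ≤ cgfObj f a b α β P h ν := by
  have hr := sub_pos.2 hαβ
  have : ∫ _, (α - shiftCut f α β ν) ∂P ≤
      ∫ x, fStarCut f a b (β - α) (h x - shiftCut f α β ν) ∂P := by
    refine integral_mono (integrable_const _)
      (integrable_fStarCut ha0 ha1 hb1 hf1 hr hz P hh _) fun x => ?_
    have h₁ := self_le_fStarR ha1 hb1 hf1
      (clamp_lt_top ha0 hr hz (h x - shiftCut f α β ν))
    rw [clamp_of_mem (sub_shiftCut_mem hαβ ν (hb x))] at h₁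
    show α - _ ≤ _
    rw [fStarCut_sub_shiftCut hαβ ν (hb x)]
    linarith [(hb x).1]
  simp only [integral_const, probReal_univ, one_smul] at this
  unfold cgfObj
  linarith

lemma cgfR_eq (ha0 : 0 ≤ a) (ha1 : a < 1) (hb1 : ((1 : ℝ) : EReal) < b)
    (hconv : ConvexOn ℝ (Dom a b) f) (hf1 : f 1 = 0) (hαβ : α < β)
    (hz : zz f + (β - α) ∈ interior {z | fStar f a b z < ⊤})
    (P : Measure X) [IsProbabilityMeasure P] {h : X → ℝ} (hh : Measurable h)
    (hb : ∀ x, h x ∈ Icc α β) :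
    cgfR f a b P h = ⨅ q : ℚ, cgfObj f a b α β P h q := by
  have hr := sub_pos.2 hαβ
  have hbdd : BddBelow (range fun q : ℚ => cgfObj f a b α β P h q) :=
    ⟨α, by rintro _ ⟨q, rfl⟩; exact le_cgfObj ha0 ha1 hb1 hf1 hαβ hz P hh hb _⟩
  have hinf : ∀ ν : ℝ, ⨅ q : ℚ, cgfObj f a b α β P h q ≤ cgfObj f a b α β P h ν := fun ν =>
    Rat.denseRange_cast.induction_on (p := fun ν => ⨅ q : ℚ, cgfObj f a b α β P h q ≤
      cgfObj f a b α β P h ν) ν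
      (isClosed_le continuous_const (continuous_cgfObj ha0 ha1 hb1 hf1 hαβ hz P hh))
      fun q => ciInf_le hbdd q
  suffices cgf f a b P h = ((⨅ q : ℚ, cgfObj f a b α β P h q : ℝ) : EReal) by
    rw [cgfR, this, EReal.toReal_coe]
  refine le_antisymm ?_ (le_iInf fun ν => ?_)
  · by_contra! hlt
    obtain ⟨r, h₁, h₂⟩ := EReal.lt_iff_exists_real_btwn.1 hlt
    obtain ⟨q, hq⟩ := exists_lt_of_ciInf_lt (EReal.coe_lt_coe_iff.1 h₁)
    refine (h₂.trans_le ?_).not_ge (EReal.coe_le_coe_iff.2 hq.le)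
    refine (iInf_le _ (shiftCut f α β q)).trans_eq ?_
    have hfin : ∀ x, fStar f a b (h x - shiftCut f α β q) < ⊤ := fun x => by
      have := clamp_lt_top ha0 hr hz (h x - shiftCut f α β q)
      rwa [clamp_of_mem (sub_shiftCut_mem hαβ _ (hb x))] at this
    have heq : ∀ x, (fStar f a b (h x - shiftCut f α β q)).toReal =
        fStarCut f a b (β - α) (h x - shiftCut f α β q) := fun x =>
      (fStarCut_sub_shiftCut hαβ _ (hb x)).symm
    have hint : Integrable (fun x => (fStar f a b (h x - shiftCut f α β q)).toReal) P := by
      simp only [heq]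
      exact integrable_fStarCut ha0 ha1 hb1 hf1 hr hz P hh _
    rw [eIntegral, if_pos ⟨ae_of_all _ fun x => (hfin x).ne, hint⟩]
    simp only [heq, cgfObj, EReal.coe_add]
  · rw [eIntegral]
    split_ifs with hν
    · rw [← EReal.coe_add, EReal.coe_le_coe_iff]
      refine (hinf ν).trans ?_
      have h₁ := integrable_fStarCut ha0 ha1 hb1 hf1 hr hz P hh (shiftCut f α β ν)
      have h₂ : ∫ x, (shiftCut f α β ν + fStarCut f a b (β - α) (h x - shiftCut f α β ν)) ∂P ≤
          ∫ x, (ν + (fStar f a b (h x - ν)).toReal) ∂P := by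
        refine integral_mono_ae ((integrable_const _).add h₁) ((integrable_const _).add hν.2) ?_
        filter_upwards [hν.1] with x hx
        exact shiftCut_add_fStarCut_le ha1 hb1 hconv hf1 hαβ ν (hb x) hx.lt_top
      rw [integral_add (integrable_const _) h₁, integral_add (integrable_const _) hν.2] at h₂
      simpa [cgfObj] using h₂
    · simp

lemma bddBelow_cgfObj (ha0 : 0 ≤ a) (ha1 : a < 1) (hb1 : ((1 : ℝ) : EReal) < b)
    (hf1 : f 1 = 0) (hαβ : α < β) (hz : zz f + (β - α) ∈ interior {z | fStar f a b z < ⊤})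
    (P : Measure X) [IsProbabilityMeasure P] {h : X → ℝ} (hh : Measurable h)
    (hb : ∀ x, h x ∈ Icc α β) : BddBelow (range fun q : ℚ => cgfObj f a b α β P h q) :=
  ⟨α, by rintro _ ⟨q, rfl⟩; exact le_cgfObj ha0 ha1 hb1 hf1 hαβ hz P hh hb _⟩

end Cumulant

lemma ConvexOn.sub_le_sub_of_le {S : Set ℝ} {φ : ℝ → ℝ} (hφ : ConvexOn ℝ S φ) {x y d : ℝ}
    (hx : x ∈ S) (hy : y + d ∈ S) (hxy : x ≤ y) (hd : 0 ≤ d) :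
    φ (x + d) - φ x ≤ φ (y + d) - φ y := by
  rcases hd.eq_or_lt with rfl | hd
  · simp
  set l := y + d - x with hl
  have hl0 : 0 < l := by linarith
  have hq : d / l ≤ 1 := by rw [div_le_one hl0]; linarith
  have hq0 : 0 ≤ d / l := by positivity
  have h₁ := hφ.2 hx hy (sub_nonneg.2 hq) hq0 (by ring)
  have h₂ := hφ.2 hx hy hq0 (sub_nonneg.2 hq) (by ring)
  have hdl : d / l * l = d := div_mul_cancel₀ _ hl0.ne'
  have e₁ : (1 - d / l) * x + d / l * (y + d) = x + d := by
    linear_combination hdl + (d / l) * (-hl)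
  have e₂ : d / l * x + (1 - d / l) * (y + d) = y := by
    linear_combination -hdl - (d / l) * (-hl)
  simp only [smul_eq_mul] at h₁ h₂
  rw [e₁] at h₁
  rw [e₂] at h₂
  linarith

section EmpiricalCumulant

variable {f : ℝ → ℝ} {a : ℝ} {b : EReal} {α β : ℝ}

/-- The objective in the variational formula for the empirical cumulant generating function. -/
noncomputable def vecObj (f : ℝ → ℝ) (a : ℝ) (b : EReal) (α β : ℝ) {m : ℕ} (y : Fin m → ℝ)
    (ν : ℝ) : ℝ :=
  shiftCut f α β ν + (m : ℝ)⁻¹ * ∑ k, fStarCut f a b (β - α) (y k - shiftCut f α β ν)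

/-- The empirical cumulant generating function as a function of the sample values. -/
noncomputable def cgfVec (f : ℝ → ℝ) (a : ℝ) (b : EReal) (α β : ℝ) {m : ℕ} (y : Fin m → ℝ) : ℝ :=
  ⨅ q : ℚ, vecObj f a b α β y q

lemma cgfR_empMeas {X : Type*} [MeasurableSpace X] (ha0 : 0 ≤ a) (ha1 : a < 1)
    (hb1 : ((1 : ℝ) : EReal) < b) (hconv : ConvexOn ℝ (Dom a b) f) (hf1 : f 1 = 0) (hαβ : α < β)
    (hz : zz f + (β - α) ∈ interior {z | fStar f a b z < ⊤}) {m : ℕ} (hm : 0 < m)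
    (xs : Fin m → X) {h : X → ℝ} (hh : Measurable h) (hb : ∀ x, h x ∈ Icc α β) :
    cgfR f a b (empMeas m xs) h = cgfVec f a b α β fun k => h (xs k) := by
  have := isProbabilityMeasure_empMeas hm xs
  rw [cgfR_eq ha0 ha1 hb1 hconv hf1 hαβ hz _ hh hb]
  have hc := (lipschitzWith_fStarCut ha0 ha1 hb1 hf1 (sub_pos.2 hαβ) hz).continuous.measurable
  refine iInf_congr fun q => ?_
  rw [cgfObj, vecObj, integral_empMeas xs
    (g := fun x => fStarCut f a b (β - α) (h x - shiftCut f α β q)) (hc.comp (hh.sub_const _))]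

lemma le_vecObj (ha0 : 0 ≤ a) (ha1 : a < 1) (hb1 : ((1 : ℝ) : EReal) < b)
    (hf1 : f 1 = 0) (hαβ : α < β) (hz : zz f + (β - α) ∈ interior {z | fStar f a b z < ⊤})
    {m : ℕ} (hm : 0 < m) {y : Fin m → ℝ} (hy : ∀ k, y k ∈ Icc α β) (ν : ℝ) :
    α ≤ vecObj f a b α β y ν := by
  have hm' : (m : ℝ) ≠ 0 := by exact_mod_cast hm.ne'
  have h : ∑ _k : Fin m, (α - shiftCut f α β ν) ≤
      ∑ k, fStarCut f a b (β - α) (y k - shiftCut f α β ν) := by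
    refine Finset.sum_le_sum fun k _ => ?_
    have h₁ := self_le_fStarR ha1 hb1 hf1
      (clamp_lt_top ha0 (sub_pos.2 hαβ) hz (y k - shiftCut f α β ν))
    rw [clamp_of_mem (sub_shiftCut_mem hαβ ν (hy k))] at h₁
    rw [fStarCut_sub_shiftCut hαβ ν (hy k)]
    linarith [(hy k).1]
  have h₁ := mul_le_mul_of_nonneg_left h (show (0 : ℝ) ≤ (m : ℝ)⁻¹ by positivity)
  simp only [Finset.sum_const, Finset.card_univ, Fintype.card_fin, nsmul_eq_mul] at h₁
  rw [inv_mul_cancel_left₀ hm'] at h₁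
  unfold vecObj
  linarith

lemma bddBelow_vecObj (ha0 : 0 ≤ a) (ha1 : a < 1) (hb1 : ((1 : ℝ) : EReal) < b)
    (hf1 : f 1 = 0) (hαβ : α < β) (hz : zz f + (β - α) ∈ interior {z | fStar f a b z < ⊤})
    {m : ℕ} (hm : 0 < m) {y : Fin m → ℝ} (hy : ∀ k, y k ∈ Icc α β) :
    BddBelow (range fun q : ℚ => vecObj f a b α β y q) :=
  ⟨α, by rintro _ ⟨q, rfl⟩; exact le_vecObj ha0 ha1 hb1 hf1 hαβ hz hm hy _⟩

lemma cgfVec_le_vecObj (ha0 : 0 ≤ a) (ha1 : a < 1) (hb1 : ((1 : ℝ) : EReal) < b)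
    (hf1 : f 1 = 0) (hαβ : α < β) (hz : zz f + (β - α) ∈ interior {z | fStar f a b z < ⊤})
    {m : ℕ} (hm : 0 < m) {y : Fin m → ℝ} (hy : ∀ k, y k ∈ Icc α β) (ν : ℝ) :
    cgfVec f a b α β y ≤ vecObj f a b α β y ν := by
  have hc := (lipschitzWith_fStarCut ha0 ha1 hb1 hf1 (sub_pos.2 hαβ) hz).continuous
  have hs : Continuous (shiftCut f α β) := continuous_clamp _ _
  have hcont : Continuous (vecObj f a b α β y) := by
    unfold vecObj
    fun_prop
  exact Rat.denseRange_cast.induction_on (p := fun ν => cgfVec f a b α β y ≤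
    vecObj f a b α β y ν) ν (isClosed_le continuous_const hcont)
    fun q => ciInf_le (bddBelow_vecObj ha0 ha1 hb1 hf1 hαβ hz hm hy) q

lemma le_cgfVec (ha0 : 0 ≤ a) (ha1 : a < 1) (hb1 : ((1 : ℝ) : EReal) < b)
    (hf1 : f 1 = 0) (hαβ : α < β) (hz : zz f + (β - α) ∈ interior {z | fStar f a b z < ⊤})
    {m : ℕ} (hm : 0 < m) {y : Fin m → ℝ} (hy : ∀ k, y k ∈ Icc α β) :
    α ≤ cgfVec f a b α β y :=
  le_ciInf fun _ => le_vecObj ha0 ha1 hb1 hf1 hαβ hz hm hy _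

lemma measurable_cgfVec (ha0 : 0 ≤ a) (ha1 : a < 1) (hb1 : ((1 : ℝ) : EReal) < b)
    (hf1 : f 1 = 0) (hαβ : α < β) (hz : zz f + (β - α) ∈ interior {z | fStar f a b z < ⊤})
    {m : ℕ} : Measurable (cgfVec f a b α β : (Fin m → ℝ) → ℝ) := by
  have hc := (lipschitzWith_fStarCut ha0 ha1 hb1 hf1 (sub_pos.2 hαβ) hz).continuous.measurable
  refine Measurable.iInf fun q => ?_
  unfold vecObj
  fun_prop

/-- Changing a single sample value. -/
lemma cgfVec_sub_le (ha0 : 0 ≤ a) (ha1 : a < 1) (hb1 : ((1 : ℝ) : EReal) < b)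
    (hf1 : f 1 = 0) (hαβ : α < β) (hz : zz f + (β - α) ∈ interior {z | fStar f a b z < ⊤})
    {m : ℕ} (hm : 0 < m) {y y' : Fin m → ℝ} (hy : ∀ k, y k ∈ Icc α β)
    (hy' : ∀ k, y' k ∈ Icc α β) {j : Fin m} (hj : ∀ k, k ≠ j → y' k = y k) :
    cgfVec f a b α β y' - cgfVec f a b α β y ≤ Δq f a b α β m / m := by
  have hm₀ : (0 : ℝ) < m := by exact_mod_cast hm
  have hr := sub_pos.2 hαβ
  rw [le_div_iff₀ hm₀]
  refine le_csInf ((nonempty_Icc.2 (by linarith)).image _) ?_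
  rintro _ ⟨z, hzI, rfl⟩
  have hmz : (m : ℝ) * (-z + (((m : ℝ) - 1) / (m : ℝ)) * fStarR f a b z
      + (1 / (m : ℝ)) * fStarR f a b (β - α + z)) =
      m * (-z + fStarR f a b z +
        (m : ℝ)⁻¹ * (fStarR f a b (β - α + z) - fStarR f a b z)) := by
    field_simp
    ring
  simp only
  rw [hmz, mul_comm]
  refine mul_le_mul_of_nonneg_left ?_ hm₀.le
  rw [sub_le_iff_le_add', ← sub_le_iff_le_add]
  refine le_ciInf fun q => ?_
  rw [sub_le_iff_le_add]
  set φ := fStarR f a b with hφ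
  set ν := shiftCut f α β q with hν
  obtain ⟨hν₁, hν₂⟩ := shiftCut_mem (f := f) hαβ q
  rw [← hν] at hν₁ hν₂
  obtain ⟨hz₁, hz₂⟩ := hzI
  have hS : ∀ t, t ≤ zz f + (β - α) → t ∈ {z | fStar f a b z < ⊤} := fun t ht =>
    fStar_lt_top_of_mem (mem_interior_of_le ha0 ht hz)
  have hmono : ∀ s t, s ≤ t → t ≤ zz f + (β - α) → φ s ≤ φ t := fun s t hst ht =>
    monotoneOn_fStarR ha0 ha1 hb1 hf1 (hS s (hst.trans ht)) (hS t ht) hst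
  have hinc : ∀ s t d, s ≤ t → 0 ≤ d → t + d ≤ zz f + (β - α) →
      φ (s + d) - φ s ≤ φ (t + d) - φ t := fun s t d hst hd ht =>
    (convexOn_fStarR ha1 hb1 hf1).sub_le_sub_of_le (hS s (by linarith)) (hS _ ht) hst hd
  have hid : ∀ t, t ≤ zz f + (β - α) → t ≤ φ t := fun t ht =>
    self_le_fStarR ha1 hb1 hf1 (hS t ht)
  have hsum : ∀ c : ℝ, ∑ k : Fin m, (if k = j then c else 0) = c := fun c => by simp
  set c := φ (β - α + z) - φ z with hc
  have hβ := hinc (α - ν) z (β - α)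
  rw [show α - ν + (β - α) = β - ν by ring, show z + (β - α) = β - α + z by ring] at hβ
  have hyc : ∀ k, fStarCut f a b (β - α) (y k - ν) = φ (y k - ν) := fun k =>
    fStarCut_sub_shiftCut hαβ _ (hy k)
  have hyc' : ∀ k, fStarCut f a b (β - α) (y' k - ν) = φ (y' k - ν) := fun k =>
    fStarCut_sub_shiftCut hαβ _ (hy' k)
  have hm₁ : (0 : ℝ) ≤ (m : ℝ)⁻¹ := by positivity
  rcases le_total (α - z) ν with hcase | hcase
  · refine (cgfVec_le_vecObj ha0 ha1 hb1 hf1 hαβ hz hm hy' q).trans ?_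
    have h : ∑ k, φ (y' k - ν) ≤ ∑ k, (φ (y k - ν) + if k = j then c else 0) := by
      refine Finset.sum_le_sum fun k _ => ?_
      by_cases hk : k = j
      · rw [if_pos hk]
        have h₁ := hβ (by linarith) hr.le (by linarith)
        have h₂ := hmono (y' k - ν) (β - ν) (by linarith [(hy' k).2]) (by linarith)
        have h₃ := hmono (α - ν) (y k - ν) (by linarith [(hy k).1]) (by linarith [(hy k).2])
        linarith
      · rw [if_neg hk, add_zero, hj k hk]
    rw [Finset.sum_add_distrib, hsum] at h
    have h' := mul_le_mul_of_nonneg_left h hm₁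
    rw [mul_add] at h'
    have := hid z (by linarith)
    simp only [vecObj, ← hν, hyc, hyc']
    linarith
  · have hμ : shiftCut f α β (α - z) = α - z := clamp_of_mem ⟨by linarith, by linarith⟩
    refine (cgfVec_le_vecObj ha0 ha1 hb1 hf1 hαβ hz hm hy' (α - z)).trans ?_
    have hyc'' : ∀ k, fStarCut f a b (β - α) (y' k - (α - z)) = φ (y' k - (α - z)) := fun k => by
      have := fStarCut_sub_shiftCut (f := f) (a := a) (b := b) hαβ (α - z) (hy' k)
      rwa [hμ] at this
    have h : ∑ k, φ (y' k - (α - z)) ≤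
        ∑ k, (φ (y k - ν) + (φ z - φ (α - ν)) + if k = j then c else 0) := by
      refine Finset.sum_le_sum fun k _ => ?_
      have hk₁ := (hy k).1
      have hk₂ := (hy k).2
      by_cases hk : k = j
      · rw [if_pos hk]
        have h₂ := hmono (y' k - (α - z)) (β - α + z) (by linarith [(hy' k).2]) (by linarith)
        have h₃ := hmono (α - ν) (y k - ν) (by linarith) (by linarith)
        linarith
      · rw [if_neg hk, add_zero, hj k hk]
        have h₁ := hinc z (α - ν) (y k - α) (by linarith) (by linarith) (by linarith)
        rw [show z + (y k - α) = y k - (α - z) by ring,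
          show α - ν + (y k - α) = y k - ν by ring] at h₁
        linarith
    rw [Finset.sum_add_distrib, Finset.sum_add_distrib, hsum] at h
    simp only [Finset.sum_const, Finset.card_univ, Fintype.card_fin, nsmul_eq_mul] at h
    have h' := mul_le_mul_of_nonneg_left h hm₁
    rw [mul_add, mul_add, inv_mul_cancel_left₀ hm₀.ne'] at h'
    have := hid (α - ν) (by linarith)
    simp only [vecObj, ← hν, hyc, hμ, hyc'']
    linarith

lemma Δq_div_nonneg (ha0 : 0 ≤ a) (ha1 : a < 1) (hb1 : ((1 : ℝ) : EReal) < b)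
    (hf1 : f 1 = 0) (hαβ : α < β) (hz : zz f + (β - α) ∈ interior {z | fStar f a b z < ⊤})
    {m : ℕ} (hm : 0 < m) : 0 ≤ Δq f a b α β m / m := by
  have h := cgfVec_sub_le ha0 ha1 hb1 hf1 hαβ hz hm (y := fun _ => α) (y' := fun _ => α)
    (fun _ => ⟨le_rfl, hαβ.le⟩) (fun _ => ⟨le_rfl, hαβ.le⟩) (j := ⟨0, hm⟩) fun _ _ => rfl
  rwa [sub_self] at h

end EmpiricalCumulant

lemma sSup_eq_ciSup_of_forall_le {A : Type*} {Γ Γ₀ : Set A} (hsub : Γ₀ ⊆ Γ) (hne : Γ₀.Nonempty)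
    {E : A → ℝ} (hb : BddAbove (range fun i : Γ₀ => E i))
    (hlim : ∀ h ∈ Γ, ∀ S, (∀ i ∈ Γ₀, E i ≤ S) → E h ≤ S) :
    sSup {r : ℝ | ∃ h ∈ Γ, r = E h} = ⨆ i : Γ₀, E i := by
  have := hne.to_subtype
  have hle : ∀ r ∈ {r : ℝ | ∃ h ∈ Γ, r = E h}, r ≤ ⨆ i : Γ₀, E i := by
    rintro _ ⟨h, hh, rfl⟩
    exact hlim h hh _ fun i hi => le_ciSup hb ⟨i, hi⟩
  obtain ⟨i, hi⟩ := hne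
  exact le_antisymm (csSup_le ⟨_, i, hsub hi, rfl⟩ hle)
    (ciSup_le fun i => le_csSup ⟨_, hle⟩ ⟨i, hsub i.2, rfl⟩)

section Pointwise

variable {X : Type*} {Γ Γ₀ : Set (X → ℝ)}

lemma empRad_eq_famRad (hsub : Γ₀ ⊆ Γ) (hne : Γ₀.Nonempty) {B : ℝ}
    (hB : ∀ h ∈ Γ, ∀ x, |h x| ≤ B)
    (hd : ∀ h ∈ Γ, ∃ s : ℕ → X → ℝ, (∀ j, s j ∈ Γ₀) ∧
      ∀ x, Tendsto (fun j => s j x) atTop (𝓝 (h x))) {m : ℕ} (y : Fin m → X) :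
    empRad Γ m y = famRad fun (i : Γ₀) k => i.1 (y k) := by
  unfold empRad famRad
  congr 1
  refine Finset.sum_congr rfl fun σ _ => ?_
  refine sSup_eq_ciSup_of_forall_le (E := fun ψ : X → ℝ => radSum σ fun k => ψ (y k)) hsub hne
    (bddAbove_range_of_abs_le fun i => abs_radSum_le σ fun k => hB _ (hsub i.2) _) ?_
  intro h hh S hS
  obtain ⟨s, hs, hlim⟩ := hd h hh
  refine le_of_tendsto' (f := fun j => radSum σ fun k => s j (y k)) (x := atTop) ?_
    fun j => hS _ (hs j)
  exact (tendsto_finsetSum _ fun k _ => (hlim (y k)).const_mul _).const_mul _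

variable [MeasurableSpace X] {f : ℝ → ℝ} {a : ℝ} {b : EReal} {α β : ℝ}

lemma mean_le {n : ℕ} (hn : 0 < n) {w : Fin n → ℝ} (hw : ∀ k, w k ≤ β) :
    (n : ℝ)⁻¹ * ∑ k, w k ≤ β := by
  have hn₀ : (0 : ℝ) < n := by exact_mod_cast hn
  rw [inv_mul_le_iff₀ hn₀]
  simpa using Finset.sum_le_sum fun k (_ : k ∈ Finset.univ) => hw k

lemma Dfg_empMeas_eq (ha0 : 0 ≤ a) (ha1 : a < 1) (hb1 : ((1 : ℝ) : EReal) < b)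
    (hconv : ConvexOn ℝ (Dom a b) f) (hf1 : f 1 = 0) (hαβ : α < β)
    (hz : zz f + (β - α) ∈ interior {z | fStar f a b z < ⊤})
    (hsub : Γ₀ ⊆ Γ) (hne : Γ₀.Nonempty) (hmeas : ∀ h ∈ Γ, Measurable h)
    (hbd : ∀ h ∈ Γ, ∀ x, h x ∈ Icc α β)
    (hd : ∀ h ∈ Γ, ∃ s : ℕ → X → ℝ, (∀ j, s j ∈ Γ₀) ∧
      ∀ x, Tendsto (fun j => s j x) atTop (𝓝 (h x)))
    {n m : ℕ} (hn : 0 < n) (hm : 0 < m) (x : Fin n → X) (x' : Fin m → X) :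
    Dfg f a b Γ (empMeas n x) (empMeas m x') =
      ⨆ i : Γ₀, ((n : ℝ)⁻¹ * ∑ k, i.1 (x k) - cgfVec f a b α β fun k => i.1 (x' k)) := by
  have hset : {r : ℝ | ∃ h ∈ Γ, r = ∫ x, h x ∂(empMeas n x) - cgfR f a b (empMeas m x') h} =
      {r : ℝ | ∃ h ∈ Γ, r = (n : ℝ)⁻¹ * ∑ k, h (x k) - cgfVec f a b α β fun k => h (x' k)} := by
    ext r
    refine exists_congr fun h => and_congr_right fun hh => ?_
    rw [integral_empMeas x (hmeas h hh),
      cgfR_empMeas ha0 ha1 hb1 hconv hf1 hαβ hz hm x' (hmeas h hh) (hbd h hh)]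
  rw [Dfg, hset]
  refine sSup_eq_ciSup_of_forall_le (E := fun h : X → ℝ =>
    (n : ℝ)⁻¹ * ∑ k, h (x k) - cgfVec f a b α β fun k => h (x' k)) hsub hne ⟨β - α, ?_⟩ ?_
  · rintro _ ⟨i, rfl⟩
    exact sub_le_sub (mean_le hn fun k => (hbd _ (hsub i.2) _).2)
      (le_cgfVec ha0 ha1 hb1 hf1 hαβ hz hm fun k => hbd _ (hsub i.2) _)
  · intro h hh S hS
    obtain ⟨s, hs, hlim⟩ := hd h hh
    have hc := (lipschitzWith_fStarCut ha0 ha1 hb1 hf1 (sub_pos.2 hαβ) hz).continuous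
    rw [sub_le_comm]
    refine le_ciInf fun q => ?_
    rw [sub_le_comm]
    refine le_of_tendsto' (f := fun j => (n : ℝ)⁻¹ * ∑ k, s j (x k) -
      vecObj f a b α β (fun k => s j (x' k)) q) (x := atTop) ?_ fun j =>
        le_trans (sub_le_sub_left ?_ _) (hS _ (hs j))
    · refine ((tendsto_finsetSum _ fun k _ => hlim (x k)).const_mul _).sub ?_
      exact tendsto_const_nhds.add ((tendsto_finsetSum _ fun k _ =>
        (hc.tendsto _).comp ((hlim (x' k)).sub_const _)).const_mul _)
    · exact cgfVec_le_vecObj ha0 ha1 hb1 hf1 hαβ hz hm (fun k => hbd _ (hsub (hs j)) _) _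

lemma integral_sub_cgfR_le_Dfg (ha0 : 0 ≤ a) (ha1 : a < 1) (hb1 : ((1 : ℝ) : EReal) < b)
    (hconv : ConvexOn ℝ (Dom a b) f) (hf1 : f 1 = 0) (hαβ : α < β)
    (hz : zz f + (β - α) ∈ interior {z | fStar f a b z < ⊤})
    (hmeas : ∀ h ∈ Γ, Measurable h) (hbd : ∀ h ∈ Γ, ∀ x, h x ∈ Icc α β)
    (Q P : Measure X) [IsProbabilityMeasure Q] [IsProbabilityMeasure P] {h : X → ℝ}
    (hh : h ∈ Γ) : ∫ x, h x ∂Q - cgfR f a b P h ≤ Dfg f a b Γ Q P := by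
  refine le_csSup ⟨β - α, ?_⟩ ⟨h, hh, rfl⟩
  rintro _ ⟨g, hg, rfl⟩
  refine sub_le_sub ?_ ?_
  · have hi : Integrable g Q := Integrable.of_mem_Icc α β (hmeas g hg).aemeasurable
      (ae_of_all _ (hbd g hg))
    have := integral_mono hi (integrable_const β) fun x => (hbd g hg x).2
    simpa using this
  · rw [cgfR_eq ha0 ha1 hb1 hconv hf1 hαβ hz P (hmeas g hg) (hbd g hg)]
    exact le_ciInf fun q => le_cgfObj ha0 ha1 hb1 hf1 hαβ hz P (hmeas g hg) (hbd g hg) _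

end Pointwise

/-- If the empirical shifted averages are uniformly close to their expectations, then so is the
empirical divergence. -/
lemma ciSup_mean_sub_cgfVec_le {X ι : Type*} [MeasurableSpace X] [Nonempty ι]
    {f : ℝ → ℝ} {a : ℝ} {b : EReal} {α β : ℝ} (ha0 : 0 ≤ a) (ha1 : a < 1)
    (hb1 : ((1 : ℝ) : EReal) < b)
    (hconv : ConvexOn ℝ (Dom a b) f) (hf1 : f 1 = 0) (hαβ : α < β)
    (hz : zz f + (β - α) ∈ interior {z | fStar f a b z < ⊤})
    (Q P : Measure X) [IsProbabilityMeasure Q] [IsProbabilityMeasure P]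
    {u : ι → X → ℝ} (hu : ∀ i, Measurable (u i)) (hub : ∀ i x, u i x ∈ Icc α β)
    {D : ℝ} (hD : ∀ i, ∫ x, u i x ∂Q - cgfR f a b P (u i) ≤ D)
    {n m : ℕ} (x : Fin n → X) (x' : Fin m → X) {B : ℝ}
    (hB : ∀ i (q : ℚ), ∫ y, fStarCut f a b (β - α) (u i y - shiftCut f α β q) ∂P -
      (m : ℝ)⁻¹ * ∑ k, fStarCut f a b (β - α) (u i (x' k) - shiftCut f α β q) ≤ B) :
    ⨆ i, ((n : ℝ)⁻¹ * ∑ k, u i (x k) - cgfVec f a b α β fun k => u i (x' k))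
      ≤ D + supDev Q u x + B := by
  refine ciSup_le fun i => ?_
  have h₁ := supDev_le Q (v := u) (B := max |α| |β|)
    (fun i x => abs_le_max_abs_abs (hub i x).1 (hub i x).2) x i
  have h₂ : cgfR f a b P (u i) - B ≤ cgfVec f a b α β fun k => u i (x' k) := by
    refine le_ciInf fun q => ?_
    have h₃ := ciInf_le (bddBelow_cgfObj ha0 ha1 hb1 hf1 hαβ hz P (hu i) (hub i)) q
    rw [← cgfR_eq ha0 ha1 hb1 hconv hf1 hαβ hz P (hu i) (hub i)] at h₃
    have h₄ := hB i q
    unfold cgfObj at h₃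
    unfold vecObj
    linarith
  linarith [hD i]

lemma exists_deviation_bound {X ι : Type*} [MeasurableSpace X] [Countable ι] [Nonempty ι]
    {f : ℝ → ℝ} {a : ℝ} {b : EReal} {α β : ℝ} (ha0 : 0 ≤ a) (ha1 : a < 1)
    (hb1 : ((1 : ℝ) : EReal) < b) (hf1 : f 1 = 0) (hαβ : α < β)
    (hz : zz f + (β - α) ∈ interior {z | fStar f a b z < ⊤})
    (P : Measure X) [IsProbabilityMeasure P]
    {u : ι → X → ℝ} (hu : ∀ i, Measurable (u i)) (hub : ∀ i x, u i x ∈ Icc α β)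
    {m : ℕ} (hm : 0 < m) :
    ∃ B : (Fin m → X) → ℝ, Integrable B (Measure.pi fun _ : Fin m => P) ∧
      (∀ x' i (q : ℚ), ∫ y, fStarCut f a b (β - α) (u i y - shiftCut f α β q) ∂P -
      (m : ℝ)⁻¹ * ∑ k, fStarCut f a b (β - α) (u i (x' k) - shiftCut f α β q) ≤ B x') ∧
      ∫ x', B x' ∂(Measure.pi fun _ : Fin m => P) ≤
        2 * (rderiv (fStarR f a b) (β - α + zz f) *
          ((∫ x', famRad (fun i (k : Fin m) => u i (x' k)) ∂(Measure.pi fun _ : Fin m => P))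
            + (β - α) / (2 * Real.sqrt m))) := by
  have hr := sub_pos.2 hαβ
  have hL := (lipschitzWith_fStarCut ha0 ha1 hb1 hf1 hr hz).neg
  have hC : ∀ t, |(-fStarCut f a b (β - α)) t| ≤
      max |fStarR f a b (zz f - (β - α))| |fStarR f a b (zz f + (β - α))| := fun t => by
    rw [Pi.neg_apply, abs_neg]
    exact abs_fStarCut_le ha0 ha1 hb1 hf1 hr hz t
  have huB : ∀ i x, |u i x| ≤ max |α| |β| := fun i x =>
    abs_le_max_abs_abs (hub i x).1 (hub i x).2
  have hs : ∀ q : ℚ, |shiftCut f α β q - ((α + β) / 2 - zz f)| ≤ (β - α) / 2 := fun q => by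
    have h := shiftCut_mem (f := f) hαβ q
    rw [abs_le]
    constructor <;> linarith [h.1, h.2]
  have hmeas : ∀ p : ι × ℚ, Measurable fun y =>
      (-fStarCut f a b (β - α)) (u p.1 y - shiftCut f α β p.2) := fun p =>
    hL.continuous.measurable.comp ((hu p.1).sub_const _)
  refine ⟨supDev P fun (p : ι × ℚ) y =>
      (-fStarCut f a b (β - α)) (u p.1 y - shiftCut f α β p.2),
    integrable_supDev P hmeas (fun p x => hC _) _, fun x' i q => ?_, ?_⟩
  · have h := supDev_le P (v := fun (p : ι × ℚ) y =>
      (-fStarCut f a b (β - α)) (u p.1 y - shiftCut f α β p.2)) (fun p x => hC _) x' (i, q)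
    simp only [Pi.neg_apply, Finset.sum_neg_distrib, integral_neg, mul_neg] at h ⊢
    linarith
  · have h := integral_supDev_comp_sub_le P hm hu huB hs hL hC
    rw [Real.coe_toNNReal _ (rderiv_fStarR_nonneg ha0 ha1 hb1 hf1 hz)] at h
    rwa [add_comm (β - α), ← div_div]

lemma exists_deviation_bound_of_lipschitzOnWith {X ι : Type*} [MeasurableSpace X] [Countable ι]
    [Nonempty ι] {f : ℝ → ℝ} {a : ℝ} {b : EReal} {α β : ℝ} (ha0 : 0 ≤ a) (ha1 : a < 1)
    (hb1 : ((1 : ℝ) : EReal) < b) (hconv : ConvexOn ℝ (Dom a b) f) (hf1 : f 1 = 0) (hαβ : α < β)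
    (hz : zz f + (β - α) ∈ interior {z | fStar f a b z < ⊤}) {L : ℝ≥0}
    (hL : LipschitzOnWith L (rderiv (fStarR f a b)) (Icc (zz f - (β - α)) (zz f + (β - α))))
    (P : Measure X) [IsProbabilityMeasure P]
    {u : ι → X → ℝ} (hu : ∀ i, Measurable (u i)) (hub : ∀ i x, u i x ∈ Icc α β)
    {m : ℕ} (hm : 0 < m) :
    ∃ B : (Fin m → X) → ℝ, Integrable B (Measure.pi fun _ : Fin m => P) ∧
      (∀ x' i (q : ℚ), ∫ y, fStarCut f a b (β - α) (u i y - shiftCut f α β q) ∂P -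
      (m : ℝ)⁻¹ * ∑ k, fStarCut f a b (β - α) (u i (x' k) - shiftCut f α β q) ≤ B x') ∧
      ∫ x', B x' ∂(Measure.pi fun _ : Fin m => P) ≤
        2 * ((1 + 2 * (β - α) * L) *
          (∫ x', famRad (fun i (k : Fin m) => u i (x' k)) ∂(Measure.pi fun _ : Fin m => P))
            + (β - α) ^ 2 * L / (2 * Real.sqrt m)) := by
  have hr := sub_pos.2 hαβ
  have huB : ∀ i x, |u i x| ≤ max |α| |β| := fun i x =>
    abs_le_max_abs_abs (hub i x).1 (hub i x).2
  have hs : ∀ q : ℚ, |shiftCut f α β q - ((α + β) / 2 - zz f)| ≤ (β - α) / 2 := fun q => by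
    have h := shiftCut_mem (f := f) hαβ q
    rw [abs_le]
    constructor <;> linarith [h.1, h.2]
  obtain ⟨D, hD⟩ : ∃ D : ℝ≥0, (D : ℝ) = β - α := ⟨⟨β - α, hr.le⟩, rfl⟩
  set r := β - α with hrdef
  set g : ℝ → ℝ := fun t => fStarCut f a b r t - clamp (zz f - r) (zz f + r) t with hg
  have hgL : LipschitzWith (L * D) g := by
    have h := lipschitzWith_fStarR_clamp_sub ha0 ha1 hb1 hconv hf1 (D := D) (L := L)
      (by rw [← NNReal.coe_pos, hD]; exact hr) (by rwa [hD]) (by rwa [hD])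
    rw [hD] at h
    exact h
  have hgL' := hgL.neg
  have hgC : ∀ t, |(-g) t| ≤
      max |fStarR f a b (zz f - r)| |fStarR f a b (zz f + r)| +
        max |zz f - r| |zz f + r| := fun t => by
    have h := clamp_mem (show zz f - r ≤ zz f + r by linarith) t
    rw [Pi.neg_apply, abs_neg]
    exact (abs_sub _ _).trans (add_le_add (abs_fStarCut_le ha0 ha1 hb1 hf1 hr hz t)
      (abs_le_max_abs_abs h.1 h.2))
  have hmeas : ∀ p : ι × ℚ, Measurable fun y => (-g) (u p.1 y - shiftCut f α β p.2) := fun p =>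
    hgL'.continuous.measurable.comp ((hu p.1).sub_const _)
  have hnu : ∀ i, Measurable fun x => -u i x := fun i => (hu i).neg
  have hnuB : ∀ i x, |-u i x| ≤ max |α| |β| := fun i x => by
    rw [abs_neg]
    exact huB i x
  have hI₁ := integrable_supDev P hnu hnuB (Measure.pi fun _ : Fin m => P)
  have hI₂ := integrable_supDev P hmeas (fun p x => hgC _) (Measure.pi fun _ : Fin m => P)
  refine ⟨fun x' => supDev P (fun i x => -u i x) x' +
      supDev P (fun (p : ι × ℚ) y => (-g) (u p.1 y - shiftCut f α β p.2)) x',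
    hI₁.add hI₂, fun x' i q => ?_, ?_⟩
  · have h₁ := supDev_le P hnuB x' i
    have h₂ := supDev_le P (v := fun (p : ι × ℚ) y => (-g) (u p.1 y - shiftCut f α β p.2))
      (fun p x => hgC _) x' (i, q)
    have hdec : ∀ y, (-g) (u i y - shiftCut f α β q) =
        u i y - shiftCut f α β q - fStarCut f a b r (u i y - shiftCut f α β q) := fun y => by
      rw [Pi.neg_apply, hg]
      simp only
      rw [clamp_of_mem (sub_shiftCut_mem hαβ q (hub i y))]
      ring
    have hui : Integrable (u i) P := Integrable.of_mem_Icc α β (hu i).aemeasurable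
      (ae_of_all _ (hub i))
    have hus : Integrable (fun y => u i y - shiftCut f α β q) P := hui.sub (integrable_const _)
    have hm₀ : (m : ℝ) ≠ 0 := by exact_mod_cast hm.ne'
    simp only [hdec] at h₂
    rw [integral_sub hus (integrable_fStarCut ha0 ha1 hb1 hf1 hr hz P (hu i) _),
      integral_sub hui (integrable_const _)] at h₂
    simp only [Finset.sum_sub_distrib, mul_sub, Finset.sum_const, Finset.card_univ,
      Fintype.card_fin, nsmul_eq_mul, inv_mul_cancel_left₀ hm₀, integral_const, probReal_univ,
      one_smul] at h₂
    simp only [Finset.sum_neg_distrib, integral_neg, mul_neg] at h₁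
    linarith
  · have h₁ := integral_supDev_le P hm hnu hnuB
    have h₂ := integral_supDev_comp_sub_le P hm hu huB hs hgL' hgC
    have hfi := integrable_famRad hu huB (Measure.pi fun _ : Fin m => P)
    have h₃ : ∫ x, famRad (fun i (k : Fin m) => -u i (x k)) ∂(Measure.pi fun _ : Fin m => P) ≤
        ∫ x, famRad (fun i (k : Fin m) => u i (x k)) ∂(Measure.pi fun _ : Fin m => P) := by
      refine integral_mono (integrable_famRad hnu hnuB _) hfi fun x => ?_
      have h := famRad_comp_le (w := fun i (k : Fin m) => u i (x k)) (fun i k => huB i (x k))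
        LipschitzWith.id.neg
      simpa using h
    have h₄ : 0 ≤ ∫ x, famRad (fun i (k : Fin m) => u i (x k)) ∂(Measure.pi fun _ : Fin m => P) :=
      integral_nonneg fun x => famRad_nonneg fun i k => huB i (x k)
    rw [integral_add hI₁ hI₂]
    refine (add_le_add h₁ h₂).trans ?_
    rw [NNReal.coe_mul, hD]
    have h₅ : 0 ≤ L * r * ∫ x, famRad (fun i (k : Fin m) => u i (x k))
        ∂(Measure.pi fun _ : Fin m => P) := mul_nonneg (by positivity) h₄
    have h₆ : r ^ 2 * L / (2 * Real.sqrt m) = L * r * (r / 2 / Real.sqrt m) := by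
      rw [div_div]
      ring
    rw [h₆]
    linarith

open ProbabilityTheory in
/-- McDiarmid's inequality for two independent samples. -/
lemma measureReal_prod_pi_ge_le {A B : Type*} [MeasurableSpace A] [MeasurableSpace B]
    (μ : Measure A) (ν : Measure B) [IsProbabilityMeasure μ] [IsProbabilityMeasure ν]
    {n m : ℕ} {c₁ c₂ : ℝ≥0} {F : (Fin n → A) × (Fin m → B) → ℝ} (hF : Measurable F) {M : ℝ}
    (hM : ∀ z, |F z| ≤ M)
    (hd₁ : ∀ x i y x', F (Function.update x i y, x') - F (x, x') ≤ c₁)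
    (hd₂ : ∀ x x' i y, F (x, Function.update x' i y) - F (x, x') ≤ c₂)
    {ε : ℝ} (hε : 0 ≤ ε) :
    ((Measure.pi fun _ : Fin n => μ).prod (Measure.pi fun _ : Fin m => ν)).real
      {z | ε ≤ F z - ∫ z, F z ∂((Measure.pi fun _ : Fin n => μ).prod
        (Measure.pi fun _ : Fin m => ν))} ≤
      Real.exp (-(2 * ε ^ 2) / (n * (c₁ : ℝ) ^ 2 + m * (c₂ : ℝ) ^ 2)) := by
  have hFx : ∀ x, Measurable fun x' => F (x, x') := fun x => hF.comp measurable_prodMk_left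
  have hFi : ∀ x, Integrable (fun x' => F (x, x')) (Measure.pi fun _ : Fin m => ν) := fun x =>
    Integrable.of_bound (hFx x).aestronglyMeasurable M (ae_of_all _ fun x' => hM _)
  have h₁ := fun x => hasSubgaussianMGF_pi ν c₂ m (hFx x) (fun x' => hM _) (hd₂ x)
  have h₂ := hasSubgaussianMGF_pi μ c₁ n (F := fun x => ∫ x', F (x, x')
      ∂(Measure.pi fun _ : Fin m => ν)) (M := M)
    (hF.stronglyMeasurable.integral_prod_right').measurable
    (fun x => by
      simpa using norm_integral_le_of_norm_le_const (μ := Measure.pi fun _ : Fin m => ν)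
        (f := fun x' => F (x, x')) (ae_of_all _ fun x' => hM (x, x')))
    (fun x i y => by
      rw [← integral_sub (hFi _) (hFi _)]
      simpa using integral_mono ((hFi _).sub (hFi _)) (integrable_const (c₁ : ℝ))
        (fun x' => hd₁ x i y x'))
  refine ((hasSubgaussianMGF_prod _ _ hF hM h₁ h₂).measure_ge_le hε).trans_eq ?_
  congr 1
  push_cast
  have h : (2 : ℝ) * (m * (c₂ / 2 : ℝ) ^ 2 + n * (c₁ / 2 : ℝ) ^ 2) =
      (n * (c₁ : ℝ) ^ 2 + m * (c₂ : ℝ) ^ 2) / 2 := by ring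
  rw [h, div_div_eq_mul_div]
  ring

lemma sum_update_sub_le {X : Type*} {α β : ℝ} {n : ℕ} {u : X → ℝ}
    (hu : ∀ x, u x ∈ Icc α β) (x : Fin n → X) (i : Fin n) (y : X) :
    (n : ℝ)⁻¹ * ∑ k, u (Function.update x i y k) - (n : ℝ)⁻¹ * ∑ k, u (x k) ≤ (β - α) / n := by
  rw [← mul_sub, ← Finset.sum_sub_distrib, Finset.sum_eq_single i]
  · rw [Function.update_self, inv_mul_eq_div]
    gcongr
    · exact (hu y).2
    · exact (hu _).1
  · intro k _ hk
    rw [Function.update_of_ne hk, sub_self]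
  · simp

section TwoSample

variable {X : Type*} [MeasurableSpace X] {f : ℝ → ℝ} {a : ℝ} {b : EReal} {α β : ℝ}

lemma cgfVec_le (ha0 : 0 ≤ a) (ha1 : a < 1) (hb1 : ((1 : ℝ) : EReal) < b)
    (hf1 : f 1 = 0) (hαβ : α < β) (hz : zz f + (β - α) ∈ interior {z | fStar f a b z < ⊤})
    {m : ℕ} (hm : 0 < m) {y : Fin m → ℝ} (hy : ∀ k, y k ∈ Icc α β) :
    cgfVec f a b α β y ≤
      β - zz f + max |fStarR f a b (zz f - (β - α))| |fStarR f a b (zz f + (β - α))| :=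
  (cgfVec_le_vecObj ha0 ha1 hb1 hf1 hαβ hz hm hy 0).trans
    (add_le_add (shiftCut_mem hαβ 0).2 (mean_le hm fun _ =>
      (le_abs_self _).trans (abs_fStarCut_le ha0 ha1 hb1 hf1 (sub_pos.2 hαβ) hz _)))

lemma ciSup_sub_ciSup_le {ι : Type*} [Nonempty ι] {p q : ι → ℝ} {c : ℝ}
    (hq : BddAbove (range q)) (h : ∀ i, p i - q i ≤ c) : (⨆ i, p i) - ⨆ i, q i ≤ c := by
  rw [sub_le_iff_le_add]
  exact ciSup_le fun i => by linarith [h i, le_ciSup hq i]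

/-- The two-sample concentration inequality for a countable family. -/
lemma measureReal_ciSup_ge_le {ι : Type*} [Countable ι] [Nonempty ι] (ha0 : 0 ≤ a) (ha1 : a < 1)
    (hb1 : ((1 : ℝ) : EReal) < b) (hconv : ConvexOn ℝ (Dom a b) f) (hf1 : f 1 = 0) (hαβ : α < β)
    (hz : zz f + (β - α) ∈ interior {z | fStar f a b z < ⊤})
    (Q P : Measure X) [IsProbabilityMeasure Q] [IsProbabilityMeasure P]
    {u : ι → X → ℝ} (hu : ∀ i, Measurable (u i)) (hub : ∀ i x, u i x ∈ Icc α β)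
    {D : ℝ} (hD : ∀ i, ∫ x, u i x ∂Q - cgfR f a b P (u i) ≤ D)
    {n m : ℕ} (hn : 0 < n) (hm : 0 < m) {B : (Fin m → X) → ℝ}
    (hBi : Integrable B (Measure.pi fun _ : Fin m => P))
    (hB : ∀ x' i (q : ℚ), ∫ y, fStarCut f a b (β - α) (u i y - shiftCut f α β q) ∂P -
      (m : ℝ)⁻¹ * ∑ k, fStarCut f a b (β - α) (u i (x' k) - shiftCut f α β q) ≤ B x')
    {R K : ℝ} (hR : ∫ x, famRad (fun i (k : Fin n) => u i (x k))
      ∂(Measure.pi fun _ : Fin n => Q) ≤ R)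
    (hK : ∫ x', B x' ∂(Measure.pi fun _ : Fin m => P) ≤ 2 * K) {ε : ℝ} (hε : 0 ≤ ε) :
    ((Measure.pi fun _ : Fin n => Q).prod (Measure.pi fun _ : Fin m => P)).real
      {z | ε + 2 * R + 2 * K ≤ (⨆ i, ((n : ℝ)⁻¹ * ∑ k, u i (z.1 k) -
        cgfVec f a b α β fun k => u i (z.2 k))) - D} ≤
      Real.exp (-(2 * ε ^ 2) /
        ((1 / (n : ℝ)) * (β - α) ^ 2 + (1 / (m : ℝ)) * (Δq f a b α β m) ^ 2)) := by
  set E : ι → (Fin n → X) × (Fin m → X) → ℝ := fun i z =>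
    (n : ℝ)⁻¹ * ∑ k, u i (z.1 k) - cgfVec f a b α β fun k => u i (z.2 k) with hE
  have huB : ∀ i x, |u i x| ≤ max |α| |β| := fun i x =>
    abs_le_max_abs_abs (hub i x).1 (hub i x).2
  obtain ⟨M, hM⟩ : ∃ M, ∀ i z, |E i z| ≤ M := by
    refine ⟨_, fun i z => (abs_sub _ _).trans (add_le_add (abs_mean_le fun k => huB i _)
      (abs_le_max_abs_abs (le_cgfVec ha0 ha1 hb1 hf1 hαβ hz hm fun k => hub i _)
        (cgfVec_le ha0 ha1 hb1 hf1 hαβ hz hm fun k => hub i _)))⟩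
  have hbdd : ∀ z, BddAbove (range fun i => E i z) := fun z =>
    bddAbove_range_of_abs_le fun i => hM i z
  have hFm : Measurable fun z => ⨆ i, E i z := by
    refine Measurable.iSup fun i => ?_
    have := hu i
    have hc := measurable_cgfVec ha0 ha1 hb1 hf1 hαβ hz (m := m)
    exact Measurable.sub (by fun_prop) (hc.comp (by fun_prop))
  have hFM : ∀ z, |⨆ i, E i z| ≤ M := fun z => abs_ciSup_le fun i => hM i z
  have hn₀ : (0 : ℝ) < n := by exact_mod_cast hn
  have hm₀ : (0 : ℝ) < m := by exact_mod_cast hm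
  obtain ⟨c₁, hc₁⟩ : ∃ c : ℝ≥0, (c : ℝ) = (β - α) / n :=
    ⟨⟨_, div_nonneg (sub_pos.2 hαβ).le hn₀.le⟩, rfl⟩
  obtain ⟨c₂, hc₂⟩ : ∃ c : ℝ≥0, (c : ℝ) = Δq f a b α β m / m :=
    ⟨⟨_, Δq_div_nonneg ha0 ha1 hb1 hf1 hαβ hz hm⟩, rfl⟩
  set μ := (Measure.pi fun _ : Fin n => Q).prod (Measure.pi fun _ : Fin m => P) with hμ
  have hFint : ∫ z, ⨆ i, E i z ∂μ ≤ D + 2 * R + 2 * K := by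
    have hS := integrable_supDev Q hu huB (Measure.pi fun _ : Fin n => Q)
    have hS₁ : Integrable (fun z : (Fin n → X) × (Fin m → X) => supDev Q u z.1) μ :=
      hS.comp_fst _
    have hB₁ : Integrable (fun z : (Fin n → X) × (Fin m → X) => B z.2) μ := hBi.comp_snd _
    have hle : ∀ z, ⨆ i, E i z ≤ D + supDev Q u z.1 + B z.2 := fun z =>
      ciSup_mean_sub_cgfVec_le ha0 ha1 hb1 hconv hf1 hαβ hz Q P hu hub hD z.1 z.2 (hB z.2)
    have hFi : Integrable (fun z => ⨆ i, E i z) μ :=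
      Integrable.of_bound hFm.aestronglyMeasurable M (ae_of_all _ hFM)
    have hDi : Integrable (fun z => D + supDev Q u z.1) μ := (integrable_const D).add hS₁
    have hGi : Integrable (fun z => D + supDev Q u z.1 + B z.2) μ := hDi.add hB₁
    refine (integral_mono hFi hGi hle).trans ?_
    have hS₂ := integral_fun_fst (μ := Measure.pi fun _ : Fin n => Q)
      (ν := Measure.pi fun _ : Fin m => P) (supDev Q u)
    have hB₂ := integral_fun_snd (μ := Measure.pi fun _ : Fin n => Q)
      (ν := Measure.pi fun _ : Fin m => P) B
    rw [integral_add hDi hB₁, integral_add (integrable_const D) hS₁,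
      hS₂, hB₂]
    simp only [integral_const, probReal_univ, one_smul]
    linarith [integral_supDev_le Q hn hu huB]
  have h := measureReal_prod_pi_ge_le Q P (F := fun z => ⨆ i, E i z) (c₁ := c₁) (c₂ := c₂)
    hFm hFM (fun x i y x' => ?_) (fun x x' i y => ?_) hε
  · rw [hc₁, hc₂] at h
    have hsq : (n : ℝ) * ((β - α) / n) ^ 2 + m * (Δq f a b α β m / m) ^ 2 =
        (1 / (n : ℝ)) * (β - α) ^ 2 + (1 / (m : ℝ)) * (Δq f a b α β m) ^ 2 := by
      field_simp
    rw [hsq] at h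
    refine le_trans (measureReal_mono (fun z hz => ?_) (measure_ne_top _ _)) h
    simp only [mem_ofPred_eq] at hz ⊢
    linarith
  · refine ciSup_sub_ciSup_le (hbdd _) fun j => ?_
    simp only [hE, sub_sub_sub_cancel_right, hc₁]
    exact sum_update_sub_le (hub j) x i y
  · refine ciSup_sub_ciSup_le (hbdd _) fun j => ?_
    simp only [hE, sub_sub_sub_cancel_left, hc₂]
    refine cgfVec_sub_le ha0 ha1 hb1 hf1 hαβ hz hm (fun k => hub j _) (fun k => hub j _)
      (j := i) fun k hk => ?_
    rw [Function.update_of_ne hk]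

end TwoSample

lemma rad_eq_integral_famRad {Y : Type*} [MeasurableSpace Y] {Γ Γ₀ : Set (Y → ℝ)}
    (hsub : Γ₀ ⊆ Γ) (hne : Γ₀.Nonempty) {B : ℝ} (hB : ∀ h ∈ Γ, ∀ x, |h x| ≤ B)
    (hd : ∀ h ∈ Γ, ∃ s : ℕ → Y → ℝ, (∀ j, s j ∈ Γ₀) ∧
      ∀ x, Tendsto (fun j => s j x) atTop (𝓝 (h x))) (P : Measure Y) (m : ℕ) :
    rad Γ P m = ∫ y, famRad (fun (i : Γ₀) (k : Fin m) => i.1 (y k))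
      ∂(Measure.pi fun _ : Fin m => P) :=
  integral_congr_ae (ae_of_all _ fun y => empRad_eq_famRad hsub hne hB hd y)

open MeasureTheory in
/-- Concentration inequality for estimation of the
`(f,Γ)`-divergence (upper deviation). -/
theorem stmt16 {X : Type*} [MeasurableSpace X]
    (Γ : Set (X → ℝ)) (hΓne : Γ.Nonempty)
    (hmeas : ∀ h ∈ Γ, Measurable h) (α β : ℝ) (hαβ : α < β)
    (hbd : ∀ h ∈ Γ, ∀ x, h x ∈ Set.Icc α β)
    (hΓd : PtwiseDenseCount Γ)
    (f : ℝ → ℝ) (a : ℝ) (b : EReal)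
    (ha0 : 0 ≤ a) (ha1 : a < 1) (hb1 : ((1 : ℝ) : EReal) < b)
    (hconv : ConvexOn ℝ (Dom a b) f) (hf1 : f 1 = 0)
    (hstrict : ∃ ε > 0, Set.Ioo (1 - ε) (1 + ε) ⊆ Dom a b ∧
      StrictConvexOn ℝ (Set.Ioo (1 - ε) (1 + ε)) f)
    (hz : zz f + β - α ∈ interior {z : ℝ | fStar f a b z < ⊤})
    (Q P : Measure X) [IsProbabilityMeasure Q] [IsProbabilityMeasure P]
    {Ω : Type*} [MeasurableSpace Ω] (ℙ : Measure Ω) [IsProbabilityMeasure ℙ]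
    (n m : ℕ) (hn : 0 < n) (hm : 0 < m)
    (Xs : Fin n → Ω → X) (Xs' : Fin m → Ω → X)
    (hXm : ∀ i, Measurable (Xs i)) (hX'm : ∀ j, Measurable (Xs' j))
    (hlaw : Measure.map (fun ω => (fun i => Xs i ω, fun j => Xs' j ω)) ℙ =
      (Measure.pi fun _ : Fin n => Q).prod (Measure.pi fun _ : Fin m => P))
    (K : ℝ) (hK : Kchoice f a b α β Γ P m K)
    (ε : ℝ) (hε : 0 < ε) :
    (ℙ {ω | Dfg f a b Γ (empMeas n fun i => Xs i ω) (empMeas m fun j => Xs' j ω)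
          - Dfg f a b Γ Q P
        ≥ ε + 2 * rad Γ Q n + 2 * K}).toReal ≤
      Real.exp (-(2 * ε ^ 2) /
        ((1 / (n : ℝ)) * (β - α) ^ 2 + (1 / (m : ℝ)) * (Δq f a b α β m) ^ 2)) := by

  rw [add_sub_assoc] at hz
  obtain ⟨Γ₀, hsub, hcount, hd⟩ := hΓd
  have hne : Γ₀.Nonempty := by
    obtain ⟨h, hh⟩ := hΓne
    obtain ⟨s, hs, -⟩ := hd h hh
    exact ⟨s 0, hs 0⟩
  have := hcount.to_subtype
  have := hne.to_subtype
  have huB : ∀ h ∈ Γ, ∀ x, |h x| ≤ max |α| |β| := fun h hh x =>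
    abs_le_max_abs_abs (hbd h hh x).1 (hbd h hh x).2
  have hu : ∀ i : Γ₀, Measurable i.1 := fun i => hmeas _ (hsub i.2)
  have hub : ∀ (i : Γ₀) x, i.1 x ∈ Icc α β := fun i => hbd _ (hsub i.2)
  have hrad := fun (P : Measure X) => rad_eq_integral_famRad hsub hne huB hd P
  obtain ⟨B, hBi, hB, hBK⟩ : ∃ B : (Fin m → X) → ℝ,
      Integrable B (Measure.pi fun _ : Fin m => P) ∧
      (∀ x' (i : Γ₀) (q : ℚ),
        ∫ y, fStarCut f a b (β - α) (i.1 y - shiftCut f α β q) ∂P -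
        (m : ℝ)⁻¹ * ∑ k, fStarCut f a b (β - α) (i.1 (x' k) - shiftCut f α β q) ≤ B x') ∧
      ∫ x', B x' ∂(Measure.pi fun _ : Fin m => P) ≤ 2 * K := by
    have h₂ := exists_deviation_bound ha0 ha1 hb1 hf1 hαβ hz P hu hub hm
    rw [← hrad] at h₂
    rcases hK with ⟨L, hL, -, rfl⟩ | rfl
    · have h₁ := exists_deviation_bound_of_lipschitzOnWith ha0 ha1 hb1 hconv hf1 hαβ hz hL P
        hu hub hm
      rw [← hrad] at h₁
      rcases min_choice ((1 + 2 * (β - α) * (L : ℝ)) * rad Γ P m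
          + (β - α) ^ 2 * (L : ℝ) / (2 * Real.sqrt m))
        (rderiv (fStarR f a b) (β - α + zz f) * (rad Γ P m + (β - α) / (2 * Real.sqrt m)))
        with h | h
      · rwa [h]
      · rwa [h]
    · exact h₂
  have hmain := measureReal_ciSup_ge_le ha0 ha1 hb1 hconv hf1 hαβ hz Q P hu hub
    (fun i => integral_sub_cgfR_le_Dfg ha0 ha1 hb1 hconv hf1 hαβ hz hmeas hbd Q P (hsub i.2))
    hn hm hBi hB (hrad Q n).ge hBK hε.le
  refine le_trans ?_ hmain
  have hT : Measurable fun ω => (fun i => Xs i ω, fun j => Xs' j ω) :=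
    (measurable_pi_lambda _ hXm).prodMk (measurable_pi_lambda _ hX'm)
  rw [← hlaw, measureReal_def]
  refine ENNReal.toReal_mono (measure_ne_top _ _) ?_
  refine le_trans (measure_mono fun ω hω => ?_) (Measure.le_map_apply hT.aemeasurable _)
  rw [mem_ofPred_eq, Dfg_empMeas_eq ha0 ha1 hb1 hconv hf1 hαβ hz hsub hne hmeas hbd hd hn hm] at hω
  exact hω
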